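/- arXiv:2010.02050 — 4 statements merged into one kernel-verified Lean document; each statement's English description precedes it below -/
import Mathlib

section
/- There exists an absolute constant c > 0 with the following property. Let A, B ⊆ ℝ be finite sets, let G ⊆ A × B, and let λ ∈ ℝ with λ ∉ {-1, 0, 1}. Then max{|A +_G B|, |A +_G λB|, |A ·_G B|} ≥ c · |G|^(6/11). -/
open Finset

/-- The number of elements of a finset is at most the number of values of a map plus the number of
ordered pairs of distinct elements on which the map agrees. -/
theorem card_le_card_image_add_card_offDiag_filter {ι τ : Type*} [DecidableEq ι] [DecidableEq τ]
    (I : Finset ι) (f : ι → τ) :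
    #I ≤ #(I.image f) + #{p ∈ I.offDiag | f p.1 = f p.2} := by
  classical
  rcases I.eq_empty_or_nonempty with rfl | ⟨i₀, -⟩
  · simp
  have : Nonempty ι := ⟨i₀⟩
  have hex : ∀ t ∈ I.image f, ∃ a ∈ I, f a = t := fun t ht => mem_image.1 ht
  choose! rep hrep hfrep using hex
  have hr : ∀ a ∈ I, rep (f a) ∈ I := fun a ha => hrep _ (mem_image_of_mem f ha)
  have hfr : ∀ a ∈ I, f (rep (f a)) = f a := fun a ha => hfrep _ (mem_image_of_mem f ha)
  rw [← card_filter_add_card_filter_not (s := I) (fun a => rep (f a) = a)]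
  refine add_le_add (card_le_card_of_injOn f ?_ ?_)
    (card_le_card_of_injOn (fun a => (a, rep (f a))) ?_ ?_)
  · intro a ha
    simp only [coe_filter, Set.mem_ofPred_eq] at ha
    exact mem_image_of_mem f ha.1
  · intro a ha b hb hab
    simp only [coe_filter, Set.mem_ofPred_eq] at ha hb
    rw [← ha.2, ← hb.2, hab]
  · intro a ha
    simp only [coe_filter, Set.mem_ofPred_eq] at ha
    simp only [coe_filter, Set.mem_ofPred_eq, mem_offDiag]
    exact ⟨⟨ha.1, hr a ha.1, fun h => ha.2 h.symm⟩, (hfr a ha.1).symm⟩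
  · intro a _ b _ hab
    exact congrArg Prod.fst hab

/-- A chain in the grid `{0, …, n} × {0, …, n}` has at most `2 * n + 1` elements. -/
theorem card_le_of_chain_grid (C : Finset (ℕ × ℕ)) (n : ℕ)
    (hn : ∀ c ∈ C, c.1 ≤ n ∧ c.2 ≤ n)
    (hC : ∀ c ∈ C, ∀ c' ∈ C, c.1 ≤ c'.1 ∧ c.2 ≤ c'.2 ∨ c'.1 ≤ c.1 ∧ c'.2 ≤ c.2) :
    #C ≤ 2 * n + 1 := by
  rw [← card_range (2 * n + 1)]
  refine card_le_card_of_injOn (fun c => c.1 + c.2) ?_ ?_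
  · intro c hc
    have := hn c hc
    simp only [coe_range, Set.mem_Iio]
    omega
  · intro c hc c' hc' h
    have := hC c hc c' hc'
    simp only at h
    ext <;> omega

/-- A chain for the order reversed in the second coordinate in the grid `{0, …, n} × {0, …, n}`
has at most `2 * n + 1` elements. -/
theorem card_le_of_antitone_chain_grid (C : Finset (ℕ × ℕ)) (n : ℕ)
    (hn : ∀ c ∈ C, c.1 ≤ n ∧ c.2 ≤ n)
    (hC : ∀ c ∈ C, ∀ c' ∈ C, c.1 ≤ c'.1 ∧ c'.2 ≤ c.2 ∨ c'.1 ≤ c.1 ∧ c.2 ≤ c'.2) :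
    #C ≤ 2 * n + 1 := by
  rw [← card_range (2 * n + 1)]
  refine card_le_card_of_injOn (fun c => c.1 + (n - c.2)) ?_ ?_
  · intro c hc
    have := hn c hc
    simp only [coe_range, Set.mem_Iio]
    omega
  · intro c hc c' hc' h
    have := hC c hc c' hc'
    have := hn c hc
    have := hn c' hc'
    simp only at h
    ext <;> omega

/-- The points of a hyperbola `(x - α)² - (y - β)² = k` meet at most `4 * (2 * n + 1)` cells of a
grid with `(n + 1)²` cells. -/
theorem card_image_hyperbola_le (T : Finset (ℝ × ℝ)) (α β k : ℝ) (φ : ℝ → ℕ) (hφ : Monotone φ)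
    (n : ℕ) (hn : ∀ p ∈ T, φ p.1 ≤ n ∧ φ p.2 ≤ n)
    (hT : ∀ p ∈ T, (p.1 - α) ^ 2 - (p.2 - β) ^ 2 = k) :
    #(T.image fun p => (φ p.1, φ p.2)) ≤ 4 * (2 * n + 1) := by
  classical
  have hsq {X X' Y Y' : ℝ} (h : X ^ 2 - Y ^ 2 = X' ^ 2 - Y' ^ 2) (hX : 0 ≤ X) (hX' : 0 ≤ X')
      (hY : 0 ≤ Y) (hY' : 0 ≤ Y') : X ≤ X' ∧ Y ≤ Y' ∨ X' ≤ X ∧ Y' ≤ Y := by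
    rcases le_total X X' with hle | hle
    · exact .inl ⟨hle, by nlinarith [mul_nonneg (sub_nonneg.2 hle) (add_nonneg hX hX')]⟩
    · exact .inr ⟨hle, by nlinarith [mul_nonneg (sub_nonneg.2 hle) (add_nonneg hX hX')]⟩
  have bnd (U : Finset (ℝ × ℝ)) (hU : U ⊆ T) :
      ∀ c ∈ U.image (fun p => (φ p.1, φ p.2)), c.1 ≤ n ∧ c.2 ≤ n := by
    intro c hc
    obtain ⟨p, hp, rfl⟩ := mem_image.1 hc
    exact hn p (hU hp)
  have chain (U : Finset (ℝ × ℝ)) (hU : U ⊆ T)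
      (h : ∀ p ∈ U, ∀ p' ∈ U, p.1 ≤ p'.1 ∧ p.2 ≤ p'.2 ∨ p'.1 ≤ p.1 ∧ p'.2 ≤ p.2) :
      #(U.image fun p => (φ p.1, φ p.2)) ≤ 2 * n + 1 := by
    refine card_le_of_chain_grid _ n (bnd U hU) ?_
    simp only [forall_mem_image]
    intro p hp p' hp'
    exact (h p hp p' hp').imp (fun h => ⟨hφ h.1, hφ h.2⟩) fun h => ⟨hφ h.1, hφ h.2⟩
  have antichain (U : Finset (ℝ × ℝ)) (hU : U ⊆ T)
      (h : ∀ p ∈ U, ∀ p' ∈ U, p.1 ≤ p'.1 ∧ p'.2 ≤ p.2 ∨ p'.1 ≤ p.1 ∧ p.2 ≤ p'.2) :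
      #(U.image fun p => (φ p.1, φ p.2)) ≤ 2 * n + 1 := by
    refine card_le_of_antitone_chain_grid _ n (bnd U hU) ?_
    simp only [forall_mem_image]
    intro p hp p' hp'
    exact (h p hp p' hp').imp (fun h => ⟨hφ h.1, hφ h.2⟩) fun h => ⟨hφ h.1, hφ h.2⟩
  have h₁ := chain {p ∈ T | α ≤ p.1 ∧ β ≤ p.2} (filter_subset _ _) (by
    intro p hp p' hp'
    simp only [mem_filter] at hp hp'
    have := hsq (X := p.1 - α) (X' := p'.1 - α) (Y := p.2 - β) (Y' := p'.2 - β)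
      (by rw [hT p hp.1, hT p' hp'.1]) (by linarith) (by linarith) (by linarith) (by linarith)
    exact this.imp (fun h => ⟨by linarith, by linarith⟩) fun h => ⟨by linarith, by linarith⟩)
  have h₂ := chain {p ∈ T | p.1 ≤ α ∧ p.2 ≤ β} (filter_subset _ _) (by
    intro p hp p' hp'
    simp only [mem_filter] at hp hp'
    have := hsq (X := α - p'.1) (X' := α - p.1) (Y := β - p'.2) (Y' := β - p.2)
      (by linarith [hT p hp.1, hT p' hp'.1]) (by linarith) (by linarith) (by linarith)
      (by linarith)
    exact this.imp (fun h => ⟨by linarith, by linarith⟩) fun h => ⟨by linarith, by linarith⟩)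
  have h₃ := antichain {p ∈ T | α ≤ p.1 ∧ p.2 ≤ β} (filter_subset _ _) (by
    intro p hp p' hp'
    simp only [mem_filter] at hp hp'
    have := hsq (X := p.1 - α) (X' := p'.1 - α) (Y := β - p.2) (Y' := β - p'.2)
      (by linarith [hT p hp.1, hT p' hp'.1]) (by linarith) (by linarith) (by linarith)
      (by linarith)
    exact this.imp (fun h => ⟨by linarith, by linarith⟩) fun h => ⟨by linarith, by linarith⟩)
  have h₄ := antichain {p ∈ T | p.1 ≤ α ∧ β ≤ p.2} (filter_subset _ _) (by
    intro p hp p' hp'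
    simp only [mem_filter] at hp hp'
    have := hsq (X := α - p'.1) (X' := α - p.1) (Y := p'.2 - β) (Y' := p.2 - β)
      (by linarith [hT p hp.1, hT p' hp'.1]) (by linarith) (by linarith) (by linarith)
      (by linarith)
    exact this.imp (fun h => ⟨by linarith, by linarith⟩) fun h => ⟨by linarith, by linarith⟩)
  have hcov : T ⊆ ({p ∈ T | α ≤ p.1 ∧ β ≤ p.2} ∪ {p ∈ T | p.1 ≤ α ∧ p.2 ≤ β}) ∪
      ({p ∈ T | α ≤ p.1 ∧ p.2 ≤ β} ∪ {p ∈ T | p.1 ≤ α ∧ β ≤ p.2}) := by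
    intro p hp
    simp only [mem_union, mem_filter, hp, true_and]
    have := le_total α p.1
    have := le_total β p.2
    tauto
  have hle := card_le_card (image_subset_image (f := fun p : ℝ × ℝ => (φ p.1, φ p.2)) hcov)
  simp only [image_union] at hle
  refine hle.trans ((card_union_le _ _).trans ?_)
  have := card_union_le (image (fun p : ℝ × ℝ => (φ p.1, φ p.2)) {p ∈ T | α ≤ p.1 ∧ β ≤ p.2})
    (image (fun p : ℝ × ℝ => (φ p.1, φ p.2)) {p ∈ T | p.1 ≤ α ∧ p.2 ≤ β})
  have := card_union_le (image (fun p : ℝ × ℝ => (φ p.1, φ p.2)) {p ∈ T | α ≤ p.1 ∧ p.2 ≤ β})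
    (image (fun p : ℝ × ℝ => (φ p.1, φ p.2)) {p ∈ T | p.1 ≤ α ∧ β ≤ p.2})
  omega

/-- The index of the interval containing `x` when the line is cut into intervals containing
at most `q` points of `D` each. -/
noncomputable def blockIndex (D : Finset ℝ) (q : ℕ) (x : ℝ) : ℕ := #{d ∈ D | d < x} / q

theorem blockIndex_mono (D : Finset ℝ) (q : ℕ) : Monotone (blockIndex D q) := by
  intro x y hxy
  refine Nat.div_le_div_right (card_le_card fun d hd => ?_)
  simp only [mem_filter] at hd ⊢
  exact ⟨hd.1, hd.2.trans_le hxy⟩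

theorem blockIndex_le (D : Finset ℝ) (q : ℕ) (x : ℝ) : blockIndex D q x ≤ #D / q :=
  Nat.div_le_div_right (card_filter_le _ _)

theorem card_filter_blockIndex_eq_le (D : Finset ℝ) {q : ℕ} (hq : 0 < q) (k : ℕ) :
    #{x ∈ D | blockIndex D q x = k} ≤ q := by
  have hcard : #(Finset.Ico (k * q) (k * q + q)) = q := by simp
  refine (card_le_card_of_injOn (fun x => #{d ∈ D | d < x}) ?_ ?_).trans_eq hcard
  · intro x hx
    simp only [coe_filter, Set.mem_ofPred_eq] at hx
    rw [blockIndex] at hx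
    have := (Nat.div_eq_iff hq).1 hx.2
    simp only [coe_Ico, Set.mem_Ico]
    omega
  · have key : ∀ x ∈ D, ∀ y, x < y → #{d ∈ D | d < x} < #{d ∈ D | d < y} := by
      intro x hx y hxy
      refine card_lt_card (Finset.ssubset_iff_of_subset ?_ |>.2 ⟨x, ?_, ?_⟩)
      · intro d hd
        simp only [mem_filter] at hd ⊢
        exact ⟨hd.1, hd.2.trans hxy⟩
      · simp [hx, hxy]
      · simp
    intro x hx y hy hxy
    simp only [coe_filter, Set.mem_ofPred_eq] at hx hy hxy
    rcases lt_trichotomy x y with h | h | h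
    · exact absurd hxy (key x hx.1 y h).ne
    · exact h
    · exact absurd hxy (key y hy.1 x h).ne'

/-- The number of pairs of elements of `D` lying in a common block. -/
theorem card_filter_blockIndex_pair_le (D : Finset ℝ) {q : ℕ} (hq : 0 < q) :
    #{p ∈ D ×ˢ D | blockIndex D q p.1 = blockIndex D q p.2} ≤ q * #D := by
  refine card_le_mul_card_image_of_maps_to (f := Prod.fst) (fun p hp => ?_) q fun x hx => ?_
  · exact (mem_product.1 (mem_filter.1 hp).1).1
  · refine le_trans (card_le_card_of_injOn Prod.snd ?_ ?_)
      (card_filter_blockIndex_eq_le D hq (blockIndex D q x))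
    · rintro ⟨a, b⟩ hp
      simp only [coe_filter, mem_filter, mem_product, Set.mem_ofPred_eq] at hp ⊢
      exact ⟨hp.1.1.2, by rw [← hp.1.2, hp.2]⟩
    · rintro ⟨a, b⟩ hp ⟨a', b'⟩ hp' h
      simp only [coe_filter, mem_filter, mem_product, Set.mem_ofPred_eq] at hp hp'
      exact Prod.ext (hp.2.trans hp'.2.symm) h

/-- A line meets the hyperbola `u * v = k` with `k ≠ 0` in at most two points. -/
theorem hyperbola_line_two_points {k α β c : ℝ} (hk : k ≠ 0) (hαβ : α ≠ 0 ∨ β ≠ 0)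
    {u₁ v₁ u₂ v₂ u₃ v₃ : ℝ} (h₁ : u₁ * v₁ = k) (h₂ : u₂ * v₂ = k) (h₃ : u₃ * v₃ = k)
    (l₁ : α * u₁ + β * v₁ = c) (l₂ : α * u₂ + β * v₂ = c) (l₃ : α * u₃ + β * v₃ = c) :
    v₁ = v₂ ∨ v₁ = v₃ ∨ v₂ = v₃ := by
  have q₁ : α * k + β * v₁ ^ 2 = c * v₁ := by rw [← h₁, ← l₁]; ring
  have q₂ : α * k + β * v₂ ^ 2 = c * v₂ := by rw [← h₂, ← l₂]; ring
  have q₃ : α * k + β * v₃ ^ 2 = c * v₃ := by rw [← h₃, ← l₃]; ring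
  by_contra! hne
  obtain ⟨n₁₂, n₁₃, n₂₃⟩ := hne
  have e₁₂ : β * (v₁ + v₂) = c :=
    mul_right_cancel₀ (sub_ne_zero.2 n₁₂) (by linear_combination q₁ - q₂)
  have e₁₃ : β * (v₁ + v₃) = c :=
    mul_right_cancel₀ (sub_ne_zero.2 n₁₃) (by linear_combination q₁ - q₃)
  have hβ : β = 0 := by
    have : β * (v₂ - v₃) = 0 := by linear_combination e₁₂ - e₁₃
    exact (mul_eq_zero.1 this).resolve_right (sub_ne_zero.2 n₂₃)
  have hα : α * k = 0 := by
    subst hβ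
    have : c = 0 := by linarith
    subst this
    linarith
  have := (mul_eq_zero.1 hα).resolve_right hk
  tauto

/-- The numbers `s, s', d, d'` come from pairs `(a, b)`, `(a', b')` with `a + b = s`,
`a + l * b = d` (and likewise for the primes) and `a * b = a' * b'` precisely when this holds,
for `l ≠ 1`. -/
def DilateCurve (l : ℝ) (γ p : ℝ × ℝ) : Prop :=
  (l * γ.1 - p.1) * (p.1 - γ.1) = (l * γ.2 - p.2) * (p.2 - γ.2)

theorem DilateCurve.hyperbola {l : ℝ} {γ p : ℝ × ℝ} (h : DilateCurve l γ p) :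
    (p.1 - (l + 1) / 2 * γ.1) ^ 2 - (p.2 - (l + 1) / 2 * γ.2) ^ 2
      = (l - 1) ^ 2 / 4 * (γ.1 ^ 2 - γ.2 ^ 2) := by
  unfold DilateCurve at h
  linear_combination -h

/-- At most two of the curves pass through two given points. -/
theorem card_filter_dilateCurve_le_two {l : ℝ} (h₁ : l ≠ -1) (h₀ : l ≠ 0) (h₂ : l ≠ 1)
    (Γ : Finset (ℝ × ℝ)) {p p' : ℝ × ℝ} (hp : p.1 ^ 2 ≠ p.2 ^ 2) (hne : p ≠ p')
    (hΓ : ∀ γ ∈ Γ, DilateCurve l γ p ∧ DilateCurve l γ p') : #Γ ≤ 2 := by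
  by_contra! hlt
  obtain ⟨γ₁, m₁, γ₂, m₂, γ₃, m₃, n₁₂, n₁₃, n₂₃⟩ := two_lt_card.1 hlt
  set μ := (l + 1) / 2 with hμ
  have hμ0 : μ ≠ 0 := by
    intro h; apply h₁; linarith
  set k := (l - 1) ^ 2 / 4 * (p.1 ^ 2 - p.2 ^ 2) with hk
  have hk0 : k ≠ 0 := by
    have := sub_ne_zero.2 h₂
    have := sub_ne_zero.2 hp
    positivity
  set X := p.1 - p'.1 with hX
  set Y := p.2 - p'.2 with hY
  set c := l * (p.1 ^ 2 - p.2 ^ 2 - p'.1 ^ 2 + p'.2 ^ 2) - 2 * μ ^ 2 * (X * p.1 - Y * p.2) with hc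
  have hu : ∀ γ ∈ Γ, ((l * γ.1 - μ * p.1) - (l * γ.2 - μ * p.2)) *
      ((l * γ.1 - μ * p.1) + (l * γ.2 - μ * p.2)) = k := by
    intro γ hγ
    have := (hΓ γ hγ).1
    unfold DilateCurve at this
    rw [hk, hμ]
    linear_combination (-l) * this
  have hl : ∀ γ ∈ Γ, (μ * (X + Y)) * ((l * γ.1 - μ * p.1) - (l * γ.2 - μ * p.2)) +
      (μ * (X - Y)) * ((l * γ.1 - μ * p.1) + (l * γ.2 - μ * p.2)) = c := by
    intro γ hγ
    obtain ⟨e₁, e₂⟩ := hΓ γ hγ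
    unfold DilateCurve at e₁ e₂
    rw [hc, hX, hY, hμ]
    linear_combination l * (e₁ - e₂)
  have hnz : μ * (X + Y) ≠ 0 ∨ μ * (X - Y) ≠ 0 := by
    by_contra! h
    have a := (mul_eq_zero.1 h.1).resolve_left hμ0
    have b := (mul_eq_zero.1 h.2).resolve_left hμ0
    exact hne (Prod.ext (by linarith) (by linarith))
  have hinj : ∀ γ ∈ Γ, ∀ γ' ∈ Γ, (l * γ.1 - μ * p.1) + (l * γ.2 - μ * p.2) =
      (l * γ'.1 - μ * p.1) + (l * γ'.2 - μ * p.2) → γ = γ' := by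
    intro γ hγ γ' hγ' h
    have hv : (l * γ'.1 - μ * p.1) + (l * γ'.2 - μ * p.2) ≠ 0 := by
      intro h0
      have := hu γ' hγ'
      rw [h0, mul_zero] at this
      exact hk0 this.symm
    have e := (hu γ hγ).trans (hu γ' hγ').symm
    rw [h] at e
    have e' := mul_right_cancel₀ hv e
    exact Prod.ext (mul_left_cancel₀ h₀ (by linarith)) (mul_left_cancel₀ h₀ (by linarith))
  rcases hyperbola_line_two_points hk0 hnz (hu _ m₁) (hu _ m₂) (hu _ m₃) (hl _ m₁) (hl _ m₂)
    (hl _ m₃) with h | h | h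
  · exact n₁₂ (hinj _ m₁ _ m₂ h)
  · exact n₁₃ (hinj _ m₁ _ m₃ h)
  · exact n₂₃ (hinj _ m₂ _ m₃ h)

open Classical in
/-- Incidences between the curves and the points of `D × D` off the diagonals. -/
theorem card_incidences_off_diagonals_le {l : ℝ} (h₁ : l ≠ -1) (h₀ : l ≠ 0) (h₂ : l ≠ 1)
    (S D : Finset ℝ) {q : ℕ} (hq : 0 < q) :
    #{i ∈ (S ×ˢ S) ×ˢ (D ×ˢ D) | DilateCurve l i.1 i.2 ∧ i.2.1 ^ 2 ≠ i.2.2 ^ 2} ≤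
      4 * (2 * (#D / q) + 1) * #S ^ 2 + 2 * (q * #D) ^ 2 := by
  set I := {i ∈ (S ×ˢ S) ×ˢ (D ×ˢ D) | DilateCurve l i.1 i.2 ∧ i.2.1 ^ 2 ≠ i.2.2 ^ 2} with hI
  set φ := blockIndex D q with hφ
  set f : (ℝ × ℝ) × (ℝ × ℝ) → (ℝ × ℝ) × (ℕ × ℕ) := fun i => (i.1, (φ i.2.1, φ i.2.2)) with hf
  have hmem : ∀ i ∈ I, i.1 ∈ S ×ˢ S ∧ i.2 ∈ D ×ˢ D ∧ DilateCurve l i.1 i.2 ∧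
      i.2.1 ^ 2 ≠ i.2.2 ^ 2 := by
    intro i hi
    rw [hI, mem_filter, mem_product] at hi
    exact ⟨hi.1.1, hi.1.2, hi.2⟩
  refine (card_le_card_image_add_card_offDiag_filter I f).trans (add_le_add ?_ ?_)
  · have hS : #S ^ 2 = #(S ×ˢ S) := by rw [card_product, sq]
    rw [hS]
    refine card_le_mul_card_image_of_maps_to (f := Prod.fst) (fun c hc => ?_) _ fun γ hγ => ?_
    · obtain ⟨i, hi, rfl⟩ := mem_image.1 hc
      exact (hmem i hi).1
    · set T := {p ∈ D ×ˢ D | DilateCurve l γ p} with hT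
      refine le_trans (card_le_card_of_injOn Prod.snd ?_ ?_)
        (card_image_hyperbola_le T _ _ _ φ (blockIndex_mono D q) (#D / q)
          (fun p _ => ⟨blockIndex_le D q _, blockIndex_le D q _⟩)
          fun p hp => (mem_filter.1 hp).2.hyperbola)
      · intro c hc
        obtain ⟨hcI, rfl⟩ := mem_filter.1 (mem_coe.1 hc)
        obtain ⟨i, hi, rfl⟩ := mem_image.1 hcI
        have := hmem i hi
        exact mem_image.2 ⟨i.2, mem_filter.2 ⟨this.2.1, this.2.2.1⟩, rfl⟩
      · intro c hc c' hc' h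
        exact Prod.ext ((mem_filter.1 (mem_coe.1 hc)).2.trans
          (mem_filter.1 (mem_coe.1 hc')).2.symm) h
  · set E := {p ∈ D ×ˢ D | φ p.1 = φ p.2} with hE
    have hEc : #(E ×ˢ E) ≤ (q * #D) ^ 2 := by
      rw [card_product, ← sq]
      exact Nat.pow_le_pow_left (card_filter_blockIndex_pair_le D hq) 2
    refine le_trans ?_ (Nat.mul_le_mul_left 2 hEc)
    refine card_le_mul_card_image_of_maps_to
      (f := fun w => ((w.1.2.1, w.2.2.1), (w.1.2.2, w.2.2.2))) (fun w hw => ?_) _ fun e he => ?_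
    · simp only [mem_filter, mem_offDiag] at hw
      have a := hmem _ hw.1.1
      have b := hmem _ hw.1.2.1
      have c := hw.2
      simp only [hf, Prod.mk.injEq] at c
      simp only [mem_product] at a b
      simp only [hE, mem_product, mem_filter]
      exact ⟨⟨⟨a.2.1.1, b.2.1.1⟩, c.2.1⟩, ⟨a.2.1.2, b.2.1.2⟩, c.2.2⟩
    · obtain ⟨⟨x, x'⟩, ⟨y, y'⟩⟩ := e
      set W := {w ∈ {w ∈ I.offDiag | f w.1 = f w.2} |
        ((w.1.2.1, w.2.2.1), (w.1.2.2, w.2.2.2)) = ((x, x'), (y, y'))} with hW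
      have hWm : ∀ w ∈ W, ∃ γ, w = ((γ, (x, y)), (γ, (x', y'))) ∧ (x, y) ≠ (x', y') ∧
          DilateCurve l γ (x, y) ∧ DilateCurve l γ (x', y') ∧ x ^ 2 ≠ y ^ 2 := by
        rintro ⟨⟨γ, x₁, y₁⟩, ⟨γ', x₂, y₂⟩⟩ hw
        simp only [hW, mem_filter, mem_offDiag, hf, Prod.mk.injEq] at hw
        obtain ⟨⟨⟨ha, hb, hab⟩, ⟨hγ, -⟩⟩, ⟨rfl, rfl⟩, rfl, rfl⟩ := hw
        subst hγ
        have a := hmem _ ha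
        have b := hmem _ hb
        refine ⟨γ, rfl, fun h => hab (by rw [h]), a.2.2.1, b.2.2.1, a.2.2.2⟩
      rcases W.eq_empty_or_nonempty with h0 | ⟨w, hw⟩
      · rw [h0]; simp
      · obtain ⟨-, -, hne, -, -, hsq⟩ := hWm w hw
        rw [← card_image_of_injOn (f := fun w => w.1.1) (s := W)]
        · refine card_filter_dilateCurve_le_two h₁ h₀ h₂ _ (p := (x, y)) (p' := (x', y')) hsq hne ?_
          intro γ hγ
          obtain ⟨w, hw, rfl⟩ := mem_image.1 hγ
          obtain ⟨γ, rfl, -, h, h', -⟩ := hWm w hw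
          exact ⟨h, h'⟩
        · intro w hw w' hw' h
          obtain ⟨γ, rfl, -⟩ := hWm w hw
          obtain ⟨γ', rfl, -⟩ := hWm w' hw'
          simp only at h
          rw [h]

open Classical in
/-- Incidences between the curves and the points of `D × D` on the diagonals. -/
theorem card_incidences_diagonals_le {l : ℝ} (h₀ : l ≠ 0) (S D : Finset ℝ) :
    #{i ∈ (S ×ˢ S) ×ˢ (D ×ˢ D) | DilateCurve l i.1 i.2 ∧ i.2.1 ^ 2 = i.2.2 ^ 2} ≤
      2 * (#S * (2 * #D)) := by
  have hdiag : #{p ∈ D ×ˢ D | p.1 ^ 2 = p.2 ^ 2} ≤ 2 * #D := by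
    refine card_le_mul_card_image_of_maps_to (f := Prod.fst)
      (fun p hp => (mem_product.1 (mem_filter.1 hp).1).1) 2 fun x _ => ?_
    refine (card_le_card (t := {(x, x), (x, -x)}) ?_).trans card_le_two
    rintro ⟨a, b⟩ h
    simp only [mem_filter] at h
    obtain ⟨⟨-, h⟩, rfl⟩ := h
    rcases sq_eq_sq_iff_eq_or_eq_neg.1 h with rfl | rfl <;> simp
  refine le_trans ?_ (Nat.mul_le_mul_left 2 (Nat.mul_le_mul_left _ hdiag))
  rw [← card_product]
  refine card_le_mul_card_image_of_maps_to (f := fun i => (i.1.1, i.2)) (fun i hi => ?_) 2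
    fun e _ => ?_
  · simp only [mem_filter, mem_product] at hi ⊢
    exact ⟨hi.1.1.1, hi.1.2, hi.2.2⟩
  · obtain ⟨s, x, y⟩ := e
    by_contra! hlt
    obtain ⟨i₁, m₁, i₂, m₂, i₃, m₃, n₁₂, n₁₃, n₂₃⟩ := two_lt_card.1 hlt
    obtain ⟨⟨s₁, t₁⟩, x₁, y₁⟩ := i₁
    obtain ⟨⟨s₂, t₂⟩, x₂, y₂⟩ := i₂
    obtain ⟨⟨s₃, t₃⟩, x₃, y₃⟩ := i₃
    simp only [mem_filter, Prod.mk.injEq] at m₁ m₂ m₃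
    obtain ⟨⟨-, e₁, -⟩, rfl, rfl, rfl⟩ := m₁
    obtain ⟨⟨-, e₂, -⟩, rfl, rfl, rfl⟩ := m₂
    obtain ⟨⟨-, e₃, -⟩, rfl, rfl, rfl⟩ := m₃
    simp only [DilateCurve] at e₁ e₂ e₃
    have k₁₂ : t₁ - t₂ ≠ 0 := fun h => n₁₂ (by rw [sub_eq_zero.1 h])
    have k₁₃ : t₁ - t₃ ≠ 0 := fun h => n₁₃ (by rw [sub_eq_zero.1 h])
    have k₂₃ : t₂ - t₃ ≠ 0 := fun h => n₂₃ (by rw [sub_eq_zero.1 h])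
    have f₁₂ : l * (t₁ + t₂) = (l + 1) * y₃ :=
      mul_right_cancel₀ k₁₂ (by linear_combination e₁ - e₂)
    have f₁₃ : l * (t₁ + t₃) = (l + 1) * y₃ :=
      mul_right_cancel₀ k₁₃ (by linear_combination e₁ - e₃)
    exact mul_ne_zero h₀ k₂₃ (by linear_combination f₁₂ - f₁₃)

/-- Cauchy–Schwarz: the number of pairs with equal image under a map. -/
theorem card_sq_le_card_image_mul_card_filter {ι τ : Type*} [DecidableEq τ] (G : Finset ι)
    (f : ι → τ) :
    #G ^ 2 ≤ #(G.image f) * #{w ∈ G ×ˢ G | f w.1 = f w.2} := by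
  classical
  have h₁ := card_eq_sum_card_image f G
  have h₂ : #{w ∈ G ×ˢ G | f w.1 = f w.2} = ∑ t ∈ G.image f, #{a ∈ G | f a = t} ^ 2 := by
    rw [card_eq_sum_card_fiberwise (f := fun w => f w.1) (t := G.image f)]
    · refine sum_congr rfl fun t _ => ?_
      rw [sq, ← card_product]
      congr 1
      ext ⟨a, b⟩
      simp only [mem_filter, mem_product]
      constructor
      · rintro ⟨⟨⟨ha, hb⟩, h⟩, rfl⟩
        exact ⟨⟨ha, rfl⟩, hb, h.symm⟩
      · rintro ⟨⟨ha, rfl⟩, hb, h⟩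
        exact ⟨⟨⟨ha, hb⟩, h.symm⟩, rfl⟩
    · intro w hw
      exact mem_image_of_mem f (mem_product.1 (mem_filter.1 hw).1).1
  rw [h₂, h₁]
  exact sq_sum_le_card_mul_sum_sq

/-- The bound with a free block length `q`. -/
theorem card_sq_le_of_card_image_le {l : ℝ} (h₁ : l ≠ -1) (h₀ : l ≠ 0) (h₂ : l ≠ 1)
    (G : Finset (ℝ × ℝ)) {M q : ℕ} (hq : 0 < q)
    (hS : #(G.image fun p => p.1 + p.2) ≤ M) (hD : #(G.image fun p => p.1 + l * p.2) ≤ M)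
    (hP : #(G.image fun p => p.1 * p.2) ≤ M) :
    #G ^ 2 ≤ M * (4 * (2 * (M / q) + 1) * M ^ 2 + 2 * (q * M) ^ 2 + 2 * (M * (2 * M))) := by
  classical
  refine (card_sq_le_card_image_mul_card_filter G fun p => p.1 * p.2).trans
    (Nat.mul_le_mul hP ?_)
  set S := G.image fun p => p.1 + p.2
  set D := G.image fun p => p.1 + l * p.2
  have hinc : #{w ∈ G ×ˢ G | w.1.1 * w.1.2 = w.2.1 * w.2.2} ≤
      #{i ∈ (S ×ˢ S) ×ˢ (D ×ˢ D) | DilateCurve l i.1 i.2} := by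
    refine card_le_card_of_injOn (fun w => ((w.1.1 + w.1.2, w.2.1 + w.2.2),
      (w.1.1 + l * w.1.2, w.2.1 + l * w.2.2))) ?_ ?_
    · rintro ⟨⟨a, b⟩, ⟨a', b'⟩⟩ hw
      simp only [coe_filter, mem_product, Set.mem_ofPred_eq] at hw
      obtain ⟨⟨hg, hg'⟩, hp⟩ := hw
      simp only [coe_filter, mem_product, Set.mem_ofPred_eq]
      refine ⟨⟨⟨mem_image.2 ⟨_, hg, rfl⟩, mem_image.2 ⟨_, hg', rfl⟩⟩,
        ⟨mem_image.2 ⟨_, hg, rfl⟩, mem_image.2 ⟨_, hg', rfl⟩⟩⟩, ?_⟩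
      simp only [DilateCurve]
      linear_combination (l - 1) ^ 2 * hp
    · have inj {a b a' b' : ℝ} (e : a + b = a' + b') (e' : a + l * b = a' + l * b') :
          a = a' ∧ b = b' := by
        have hb : b = b' :=
          mul_left_cancel₀ (sub_ne_zero.2 h₂) (by linear_combination e' - e)
        exact ⟨by linarith, hb⟩
      rintro ⟨⟨a, b⟩, ⟨a', b'⟩⟩ - ⟨⟨c, d⟩, ⟨c', d'⟩⟩ - h
      simp only [Prod.mk.injEq] at h ⊢
      exact ⟨inj h.1.1 h.2.1, inj h.1.2 h.2.2⟩
  refine hinc.trans ?_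
  rw [← card_filter_add_card_filter_not (fun i => i.2.1 ^ 2 ≠ i.2.2 ^ 2), filter_filter,
    filter_filter]
  simp only [not_not]
  refine (add_le_add (card_incidences_off_diagonals_le h₁ h₀ h₂ S D hq)
    (card_incidences_diagonals_le h₀ S D)).trans ?_
  gcongr

/-- **Sums, products and dilates on sparse graphs** (main theorem).
There is an absolute constant `c > 0` such that for all finite `A, B ⊆ ℝ`,
`G ⊆ A × B` and `λ ∉ {-1, 0, 1}`,
`max {|A +_G B|, |A +_G λB|, |A ·_G B|} ≥ c · |G|^(6/11)`. -/
theorem sums_products_dilates_sparse_graphs :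
    ∃ c : ℝ, 0 < c ∧
      ∀ (A B : Finset ℝ) (G : Finset (ℝ × ℝ)), G ⊆ A ×ˢ B →
        ∀ lam : ℝ, lam ≠ -1 → lam ≠ 0 → lam ≠ 1 →
          c * (G.card : ℝ) ^ ((6 : ℝ) / 11) ≤
            ((max (max (G.image (fun p => p.1 + p.2)).card
                       (G.image (fun p => p.1 + lam * p.2)).card)
                  (G.image (fun p => p.1 * p.2)).card : ℕ) : ℝ) := by
  refine ⟨1 / 26, by norm_num, fun A B G _ l h₁ h₀ h₂ => ?_⟩
  set M := max (max #(G.image fun p => p.1 + p.2) #(G.image fun p => p.1 + l * p.2))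
    #(G.image fun p => p.1 * p.2) with hM
  rcases G.eq_empty_or_nonempty with rfl | hG
  · simp
  have hM1 : 1 ≤ M := by
    have : 0 < #(G.image fun p => p.1 * p.2) := card_pos.2 (hG.image _)
    omega
  have hM1' : (1 : ℝ) ≤ M := by exact_mod_cast hM1
  set t : ℝ := (M : ℝ) ^ ((1 : ℝ) / 3) with ht
  have ht1 : 1 ≤ t := Real.one_le_rpow hM1' (by norm_num)
  have ht3 : t ^ 3 = M := by
    rw [ht, ← Real.rpow_natCast, ← Real.rpow_mul (by positivity)]
    norm_num
  set q := ⌊t⌋₊ with hq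
  have hq0 : 0 < q := Nat.floor_pos.2 ht1
  have hqt : (q : ℝ) ≤ t := Nat.floor_le (by linarith)
  have htq : t ≤ 2 * q := by
    have := Nat.lt_floor_add_one t
    have : (1 : ℝ) ≤ q := by exact_mod_cast hq0
    linarith
  have key := card_sq_le_of_card_image_le h₁ h₀ h₂ G hq0 (M := M) (by omega) (by omega) (by omega)
  have hdiv : ((M / q : ℕ) : ℝ) ≤ 2 * t ^ 2 := by
    refine Nat.cast_div_le.trans ?_
    rw [div_le_iff₀ (by exact_mod_cast hq0), ← ht3]
    nlinarith [sq_nonneg t, mul_le_mul_of_nonneg_left htq (sq_nonneg t)]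
  have key' : (#G : ℝ) ^ 2 ≤ 26 * t ^ 11 := by
    have k : (#G : ℝ) ^ 2 ≤ M * (4 * (2 * ((M / q : ℕ) : ℝ) + 1) * M ^ 2 + 2 * (q * M) ^ 2
        + 2 * (M * (2 * M))) := by exact_mod_cast key
    refine k.trans ?_
    rw [← ht3]
    calc _ ≤ t ^ 3 * (4 * (2 * (2 * t ^ 2) + 1) * (t ^ 3) ^ 2 + 2 * (t * t ^ 3) ^ 2
        + 2 * (t ^ 3 * (2 * t ^ 3))) := by gcongr
      _ = 18 * t ^ 11 + 8 * t ^ 9 := by ring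
      _ ≤ 18 * t ^ 11 + 8 * t ^ 11 := by gcongr; norm_num
      _ = 26 * t ^ 11 := by ring
  have hpow : (#G : ℝ) ^ ((6 : ℝ) / 11) ≤ 26 * M := by
    calc (#G : ℝ) ^ ((6 : ℝ) / 11) = ((#G : ℝ) ^ 2) ^ ((3 : ℝ) / 11) := by
          rw [← Real.rpow_natCast, ← Real.rpow_mul (by positivity)]; norm_num
      _ ≤ (26 * t ^ 11) ^ ((3 : ℝ) / 11) := by gcongr
      _ = 26 ^ ((3 : ℝ) / 11) * M := by
          rw [Real.mul_rpow (by norm_num) (by positivity), ← ht3, ← Real.rpow_natCast t 11,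
            ← Real.rpow_mul (by positivity), ← Real.rpow_natCast t 3]
          norm_num
      _ ≤ 26 ^ (1 : ℝ) * M := by gcongr <;> norm_num
      _ = 26 * M := by rw [Real.rpow_one]
  linarith
end

section
/- There exists an absolute constant c > 0 with the following property. Let A, B ⊆ ℝ be finite sets and let G ⊆ A × B. Then max{|π₁(G)|, |A +_G B|, |A ·_G B|} ≥ c · |G|^(6/11), where π₁(G) := {a : ∃ b, (a,b) ∈ G} is the projection of G onto its first coordinate. (This is the case λ = 0 of the main theorem, with A +_G 0·B interpreted as {a : ∃ b, (a,b) ∈ G}.) -/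
open Finset in
/-- A map from `E` to `T` has at least `#E - #T` collisions. -/
theorem Finset.card_le_card_add_card_collisions {α β : Type*} [DecidableEq α] [DecidableEq β]
    {E : Finset α} {T : Finset β} {f : α → β} (hf : ∀ e ∈ E, f e ∈ T) :
    #E ≤ #T + #{p ∈ E.offDiag | f p.1 = f p.2} := by
  classical
  rcases E.eq_empty_or_nonempty with rfl | ⟨e₀, -⟩
  · simp
  have : Nonempty α := ⟨e₀⟩
  have hinv : ∀ e ∈ E, Function.invFunOn f E (f e) ∈ E ∧ f (Function.invFunOn f E (f e)) = f e :=
    fun e he => ⟨Function.invFunOn_mem ⟨e, he, rfl⟩, Function.invFunOn_eq ⟨e, he, rfl⟩⟩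
  rw [← card_filter_add_card_filter_not (fun e => Function.invFunOn f E (f e) = e)]
  gcongr
  · refine card_le_card_of_injOn f (fun e he => hf e (mem_filter.1 he).1) ?_
    intro x hx y hy hxy
    rw [← (mem_filter.1 hx).2, ← (mem_filter.1 hy).2, hxy]
  · refine card_le_card_of_injOn (fun e => (e, Function.invFunOn f E (f e))) ?_ ?_
    · intro e he
      obtain ⟨he, hne⟩ := mem_filter.1 he
      simpa [he, (hinv e he).1, (hinv e he).2] using Ne.symm hne
    · intro x _ y _ hxy
      exact congrArg Prod.fst hxy

open Finset in
/-- The Cauchy–Schwarz bound for the number of pairs on which `f` agrees. -/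
theorem Finset.card_sq_le_card_mul_card_agreements {α β : Type*} [DecidableEq α] [DecidableEq β]
    {E : Finset α} {T : Finset β} {f : α → β} (hf : ∀ e ∈ E, f e ∈ T) :
    #E ^ 2 ≤ #T * #{p ∈ E ×ˢ E | f p.1 = f p.2} := by
  rw [card_eq_sum_card_fiberwise hf]
  refine sq_sum_le_card_mul_sum_sq.trans_eq ?_
  rw [card_eq_sum_card_fiberwise (s := {p ∈ E ×ˢ E | f p.1 = f p.2}) (f := fun p => f p.1) (t := T)
    (fun p hp => hf _ (mem_product.1 (mem_filter.1 hp).1).1)]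
  congr 1
  refine sum_congr rfl fun t _ => ?_
  rw [sq, ← card_product]
  congr 1
  ext p
  simp only [mem_product, mem_filter]
  grind

namespace SparseSumProduct

open Finset

/-- The index of the block containing `s` when `S` is cut, in increasing order, into blocks of
`q` consecutive elements. -/
noncomputable def block (S : Finset ℝ) (q : ℕ) (s : ℝ) : ℕ := #{t ∈ S | t < s} / q

theorem block_mono (S : Finset ℝ) (q : ℕ) : Monotone (block S q) := fun _ _ h =>
  Nat.div_le_div_right <| card_le_card fun _ ht =>
    mem_filter.2 ⟨(mem_filter.1 ht).1, (mem_filter.1 ht).2.trans_le h⟩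

theorem block_le (S : Finset ℝ) (q : ℕ) (s : ℝ) : block S q s ≤ #S / q :=
  Nat.div_le_div_right (card_filter_le _ _)

theorem card_filter_block_eq_le (S : Finset ℝ) {q : ℕ} (hq : 0 < q) (k : ℕ) :
    #{t ∈ S | block S q t = k} ≤ q := by
  have hinj : Set.InjOn (fun s => #{t ∈ S | t < s}) S := by
    refine StrictMonoOn.injOn fun x hx y _ hxy => card_lt_card ?_
    refine (ssubset_iff_of_subset fun t ht => ?_).2 ⟨x, ?_, ?_⟩
    · exact mem_filter.2 ⟨(mem_filter.1 ht).1, (mem_filter.1 ht).2.trans hxy⟩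
    · exact mem_filter.2 ⟨hx, hxy⟩
    · simp
  calc #{t ∈ S | block S q t = k} ≤ #(Ico (k * q) (k * q + q)) := by
        refine card_le_card_of_injOn (fun s => #{t ∈ S | t < s}) ?_ ?_
        · intro s hs
          have h := (mem_filter.1 hs).2
          rw [block, Nat.div_eq_iff hq] at h
          simp only [coe_Ico, Set.mem_Ico]
          omega
        · exact hinj.mono fun s hs => (mem_filter.1 hs).1
    _ = q := by simp

theorem card_same_block_le (S : Finset ℝ) {q : ℕ} (hq : 0 < q) :
    #{p ∈ S ×ˢ S | block S q p.1 = block S q p.2} ≤ #S * q := by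
  rw [card_eq_sum_card_fiberwise (f := Prod.fst) (t := S)
    (fun p hp => (mem_product.1 (mem_filter.1 hp).1).1)]
  refine (sum_le_card_nsmul _ _ q fun s _ => ?_).trans_eq (by simp)
  refine le_trans ?_ (card_filter_block_eq_le S hq (block S q s))
  refine card_le_card_of_injOn Prod.snd ?_ ?_
  · intro p hp
    simp only [coe_filter, mem_filter, mem_product, Set.mem_ofPred_eq] at hp ⊢
    exact ⟨hp.1.1.2, by rw [← hp.1.2, hp.2]⟩
  · intro p hp p' hp' h
    exact Prod.ext ((mem_filter.1 hp).2.trans (mem_filter.1 hp').2.symm) h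

/-- An index separating the cells of the block grid met by a line `a s - a' s' = const`. -/
noncomputable def cellIndex (S : Finset ℝ) (q : ℕ) (a a' s s' : ℝ) : ℕ :=
  if 0 < a * a' then block S q s + block S q s' else block S q s + (#S / q + 1 - block S q s')

theorem cellIndex_lt (S : Finset ℝ) (q : ℕ) (a a' s s' : ℝ) :
    cellIndex S q a a' s s' < 2 * (#S / q + 1) := by
  have h := block_le S q s
  have h' := block_le S q s'
  unfold cellIndex
  split_ifs <;> omega

theorem block_eq_of_cellIndex_eq {S : Finset ℝ} {q : ℕ} {a a' s s' t t' : ℝ}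
    (ha' : a' ≠ 0) (hline : a * (s - t) = a' * (s' - t'))
    (h : cellIndex S q a a' s s' = cellIndex S q a a' t t') :
    block S q s = block S q t ∧ block S q s' = block S q t' := by
  wlog hst : s ≤ t generalizing s s' t t'
  · have := this (s := t) (s' := t') (t := s) (t' := s') (by linarith) h.symm (le_of_not_ge hst)
    exact ⟨this.1.symm, this.2.symm⟩
  have hb := block_mono S q hst
  have hs' := block_le S q s'
  have ht' := block_le S q t'
  have key : a * a' * (s - t) = a' ^ 2 * (s' - t') := by linear_combination a' * hline
  have hpos : 0 < a' ^ 2 := by positivity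
  unfold cellIndex at h
  split_ifs at h with hc
  · have : s' ≤ t' := by
      by_contra! hlt
      nlinarith [mul_pos hpos (sub_pos.2 hlt), mul_nonneg hc.le (sub_nonneg.2 hst)]
    have hb' := block_mono S q this
    omega
  · have : t' ≤ s' := by
      by_contra! hlt
      nlinarith [mul_pos hpos (sub_pos.2 hlt),
        mul_nonneg (neg_nonneg.2 (not_lt.1 hc)) (sub_nonneg.2 hst)]
    have hb' := block_mono S q this
    omega

/-- Two distinct points lie on at most one line `a (s - a) = a' (s' - a')` with `a ^ 2 ≠ a' ^ 2`. -/
theorem line_unique {a a' c c' s s' t t' : ℝ} (ha : a ≠ 0) (hc : c ≠ 0)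
    (haa : a ^ 2 ≠ a' ^ 2) (hne : s ≠ t ∨ s' ≠ t')
    (h₁ : a * (s - a) = a' * (s' - a')) (h₂ : a * (t - a) = a' * (t' - a'))
    (h₃ : c * (s - c) = c' * (s' - c')) (h₄ : c * (t - c) = c' * (t' - c')) :
    a = c ∧ a' = c' := by
  have hs : s' - t' ≠ 0 := by
    intro h0
    have : a * (s - t) = 0 := by linear_combination h₁ - h₂ + a' * h0
    have hst : s - t = 0 := (mul_eq_zero.1 this).resolve_left ha
    rcases hne with h | h
    · exact h (sub_eq_zero.1 hst)
    · exact h (sub_eq_zero.1 h0)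
  have hdet : a * c' = a' * c := by
    refine mul_right_cancel₀ hs ?_
    linear_combination c * (h₁ - h₂) - a * (h₃ - h₄)
  have hac : (a - c) * (c * (a ^ 2 - a' ^ 2)) = 0 := by
    have h5 : a ^ 2 * (c * (s - c) - c' * (s' - c')) = 0 := by rw [h₃]; ring
    have h6 : a * c * (a * (s - a) - a' * (s' - a')) = 0 := by rw [h₁]; ring
    linear_combination h5 - h6 + (a * s' - (a * c' + a' * c)) * hdet
  have hac' : a = c := by
    rcases mul_eq_zero.1 hac with h | h
    · exact sub_eq_zero.1 h
    · exact absurd h (mul_ne_zero hc (sub_ne_zero.2 haa))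
  refine ⟨hac', mul_left_cancel₀ ha ?_⟩
  rw [hdet, ← hac']; ring

/-- An incidence bound for the grid of sums and the lines `a (s - a) = a' (s' - a')`. -/
theorem card_nondegenerate_le (G : Finset (ℝ × ℝ)) (hG : ∀ g ∈ G, g.1 ≠ 0) {q M : ℕ} (hq : 0 < q)
    (hA : #(G.image Prod.fst) ≤ M) (hS : #(G.image fun p => p.1 + p.2) ≤ M) :
    #{p ∈ G ×ˢ G | p.1.1 * p.1.2 = p.2.1 * p.2.2 ∧ p.1.1 ^ 2 ≠ p.2.1 ^ 2} ≤
      M ^ 2 * (2 * (M / q + 1)) + (M * q) ^ 2 := by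
  set A := G.image Prod.fst
  set S := G.image (fun p => p.1 + p.2)
  set E := {p ∈ G ×ˢ G | p.1.1 * p.1.2 = p.2.1 * p.2.2 ∧ p.1.1 ^ 2 ≠ p.2.1 ^ 2} with hE
  set D := {p ∈ S ×ˢ S | block S q p.1 = block S q p.2} with hD
  have hmemE : ∀ p ∈ E, p.1 ∈ G ∧ p.2 ∈ G ∧ p.1.1 * p.1.2 = p.2.1 * p.2.2 ∧
      p.1.1 ^ 2 ≠ p.2.1 ^ 2 := by
    intro p hp
    simpa only [hE, mem_filter, mem_product, and_assoc] using hp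
  have hmemA : ∀ g ∈ G, g.1 ∈ A := fun g hg => mem_image_of_mem Prod.fst hg
  have hmemS : ∀ g ∈ G, g.1 + g.2 ∈ S := fun g hg => mem_image_of_mem (fun p => p.1 + p.2) hg
  have hcoll := card_le_card_add_card_collisions (E := E)
    (T := (A ×ˢ A) ×ˢ range (2 * (#S / q + 1)))
    (f := fun p => ((p.1.1, p.2.1),
      cellIndex S q p.1.1 p.2.1 (p.1.1 + p.1.2) (p.2.1 + p.2.2))) (by
      intro p hp
      obtain ⟨h1, h2, -⟩ := hmemE p hp
      exact mem_product.2 ⟨mem_product.2 ⟨hmemA p.1 h1, hmemA p.2 h2⟩,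
        mem_range.2 (cellIndex_lt _ _ _ _ _ _)⟩)
  refine hcoll.trans (add_le_add ?_ ?_)
  · rw [card_product, card_product, card_range, sq]
    gcongr
  · refine le_trans ?_ (Nat.pow_le_pow_left
      ((card_same_block_le S hq).trans (Nat.mul_le_mul_right q hS)) 2)
    rw [← hD, sq, ← card_product]
    refine card_le_card_of_injOn (fun x => ((x.1.1.1 + x.1.1.2, x.2.1.1 + x.2.1.2),
      (x.1.2.1 + x.1.2.2, x.2.2.1 + x.2.2.2))) ?_ ?_
    · rintro ⟨p, r⟩ hx
      simp only [coe_filter, mem_offDiag, Set.mem_ofPred_eq, Prod.mk.injEq] at hx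
      obtain ⟨⟨hp, hr, -⟩, ⟨e1, e2⟩, e3⟩ := hx
      obtain ⟨p1, p2, hpp, -⟩ := hmemE p hp
      obtain ⟨r1, r2, hrr, -⟩ := hmemE r hr
      obtain ⟨b1, b2⟩ := block_eq_of_cellIndex_eq (hG _ p2)
        (s := p.1.1 + p.1.2) (t := r.1.1 + r.1.2) (s' := p.2.1 + p.2.2) (t' := r.2.1 + r.2.2)
        (by rw [← e1, ← e2] at hrr ⊢; linear_combination hpp - hrr) (by rw [e3, e1, e2])
      simp only [coe_product, Set.mem_prod, mem_coe, hD, mem_filter, mem_product]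
      exact ⟨⟨⟨hmemS _ p1, hmemS _ r1⟩, b1⟩, ⟨⟨hmemS _ p2, hmemS _ r2⟩, b2⟩⟩
    · rintro ⟨⟨⟨a, b⟩, a', b'⟩, ⟨⟨u, v⟩, u', v'⟩⟩ hx ⟨⟨⟨c, d⟩, c', d'⟩, ⟨⟨w, z⟩, w', z'⟩⟩ hy hxy
      simp only [coe_filter, mem_offDiag, Set.mem_ofPred_eq, Prod.mk.injEq] at hx hy hxy
      obtain ⟨⟨hp, hr, hne⟩, ⟨rfl, rfl⟩, -⟩ := hx
      obtain ⟨⟨hp', hr', -⟩, ⟨rfl, rfl⟩, -⟩ := hy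
      obtain ⟨⟨e1, e2⟩, e3, e4⟩ := hxy
      obtain ⟨p1, p2, hpp, hsq⟩ := hmemE _ hp
      obtain ⟨-, -, hrr, -⟩ := hmemE _ hr
      obtain ⟨p1', -, hpp', -⟩ := hmemE _ hp'
      obtain ⟨-, -, hrr', -⟩ := hmemE _ hr'
      dsimp only at hpp hsq hrr hpp' hrr'
      have hne' : a + b ≠ a + v ∨ a' + b' ≠ a' + v' := by
        by_contra! h
        exact hne (by rw [add_left_cancel h.1, add_left_cancel h.2])
      obtain ⟨rfl, rfl⟩ := line_unique (c := c) (c' := c') (hG _ p1) (hG _ p1') hsq hne'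
        (by linear_combination hpp) (by linear_combination hrr)
        (by rw [e1, e3]; linear_combination hpp') (by rw [e2, e4]; linear_combination hrr')
      rw [add_left_cancel e1, add_left_cancel e2, add_left_cancel e3, add_left_cancel e4]

theorem card_degenerate_le (G : Finset (ℝ × ℝ)) (hG : ∀ g ∈ G, g.1 ≠ 0) {M : ℕ}
    (hA : #(G.image Prod.fst) ≤ M) (hS : #(G.image fun p => p.1 + p.2) ≤ M) :
    #{p ∈ G ×ˢ G | p.1.1 * p.1.2 = p.2.1 * p.2.2 ∧ p.1.1 ^ 2 = p.2.1 ^ 2} ≤ 2 * M ^ 2 := by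
  set A := G.image Prod.fst
  set S := G.image (fun p => p.1 + p.2)
  have hmemA : ∀ g ∈ G, g.1 ∈ A := fun g hg => mem_image_of_mem Prod.fst hg
  calc #{p ∈ G ×ˢ G | p.1.1 * p.1.2 = p.2.1 * p.2.2 ∧ p.1.1 ^ 2 = p.2.1 ^ 2}
      ≤ #((univ : Finset Bool) ×ˢ (A ×ˢ S)) := by
        refine card_le_card_of_injOn
          (fun p => (decide (p.1.1 = p.2.1), (p.1.1, p.1.1 + p.1.2))) ?_ ?_
        · intro p hp
          simp only [coe_filter, mem_product, Set.mem_ofPred_eq] at hp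
          exact mem_product.2 ⟨mem_univ _, mem_product.2 ⟨hmemA p.1 hp.1.1,
            mem_image_of_mem (fun p : ℝ × ℝ => p.1 + p.2) hp.1.1⟩⟩
        · rintro ⟨⟨a, b⟩, a', b'⟩ hx ⟨⟨c, d⟩, c', d'⟩ hy hxy
          simp only [coe_filter, mem_product, Set.mem_ofPred_eq, Prod.mk.injEq,
            decide_eq_decide] at hx hy hxy
          obtain ⟨hiff, rfl, h⟩ := hxy
          obtain rfl := add_left_cancel h
          have ha' := hG _ hx.1.2
          have hac : a' = c' := by
            rcases sq_eq_sq_iff_eq_or_eq_neg.1 hx.2.2 with h1 | h1 <;>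
            rcases sq_eq_sq_iff_eq_or_eq_neg.1 hy.2.2 with h2 | h2 <;> grind
          subst hac
          rw [mul_left_cancel₀ ha' (hx.2.1.symm.trans hy.2.1)]
    _ = 2 * (#A * #S) := by simp [card_product]
    _ ≤ 2 * M ^ 2 := by rw [sq]; gcongr

theorem card_sq_le (G : Finset (ℝ × ℝ)) (hG : ∀ g ∈ G, g.1 ≠ 0) {q M : ℕ} (hq : 0 < q)
    (hA : #(G.image Prod.fst) ≤ M) (hS : #(G.image fun p => p.1 + p.2) ≤ M)
    (hP : #(G.image fun p => p.1 * p.2) ≤ M) :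
    #G ^ 2 ≤ M * (M ^ 2 * (2 * (M / q + 1)) + (M * q) ^ 2 + 2 * M ^ 2) := by
  refine (card_sq_le_card_mul_card_agreements (E := G) (f := fun p => p.1 * p.2)
    (fun g hg => mem_image_of_mem _ hg)).trans (Nat.mul_le_mul hP ?_)
  rw [← card_filter_add_card_filter_not (fun p => p.1.1 ^ 2 ≠ p.2.1 ^ 2), filter_filter,
    filter_filter]
  simp only [not_not]
  exact add_le_add (card_nondegenerate_le G hG hq hA hS) (card_degenerate_le G hG hA hS)

theorem card_le_of_fst_ne_zero (G : Finset (ℝ × ℝ)) (hG : ∀ g ∈ G, g.1 ≠ 0) {M : ℕ} {x : ℝ}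
    (hx : 1 ≤ x) (hM : (M : ℝ) = x ^ 6)
    (hA : #(G.image Prod.fst) ≤ M) (hS : #(G.image fun p => p.1 + p.2) ≤ M)
    (hP : #(G.image fun p => p.1 * p.2) ≤ M) : (#G : ℝ) ≤ 4 * x ^ 11 := by
  have hx0 : 0 < x := by linarith
  have hx2 : 1 ≤ x ^ 2 := one_le_pow₀ hx
  have hx4 : 1 ≤ x ^ 4 := one_le_pow₀ hx
  set q := ⌈x ^ 2⌉₊
  have hq : 0 < q := Nat.ceil_pos.2 (by positivity)
  have hq1 : x ^ 2 ≤ q := Nat.le_ceil _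
  have hq2 : (q : ℝ) ≤ 2 * x ^ 2 := by linarith [Nat.ceil_lt_add_one (a := x ^ 2) (by positivity)]
  have hdiv : ((M / q : ℕ) : ℝ) ≤ x ^ 4 := by
    refine Nat.cast_div_le.trans ?_
    rw [hM, div_le_iff₀ (by positivity)]
    nlinarith [mul_le_mul_of_nonneg_left hq1 (by positivity : 0 ≤ x ^ 4)]
  have h : (#G : ℝ) ^ 2 ≤
      M * (M ^ 2 * (2 * ((M / q : ℕ) + 1)) + (M * q) ^ 2 + 2 * M ^ 2) := by
    exact_mod_cast card_sq_le G hG hq hA hS hP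
  refine le_of_sq_le_sq (h.trans ?_) (by positivity)
  rw [hM]
  calc x ^ 6 * ((x ^ 6) ^ 2 * (2 * (((M / q : ℕ) : ℝ) + 1)) + (x ^ 6 * q) ^ 2 + 2 * (x ^ 6) ^ 2)
      ≤ x ^ 6 * ((x ^ 6) ^ 2 * (2 * (x ^ 4 + x ^ 4)) + (x ^ 6 * (2 * x ^ 2)) ^ 2
          + 2 * (x ^ 6) ^ 2 * x ^ 4) := by
        have := le_mul_of_one_le_right (by positivity : 0 ≤ 2 * (x ^ 6) ^ 2) hx4
        gcongr x ^ 6 * (_ * (2 * (?_ + ?_)) + (_ * ?_) ^ 2 + ?_)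
    _ ≤ (4 * x ^ 11) ^ 2 := by
        have : 0 ≤ x ^ 22 := by positivity
        nlinarith

theorem card_le_of_fst_eq_zero (G : Finset (ℝ × ℝ)) (hG : ∀ g ∈ G, g.1 = 0) :
    #G ≤ #(G.image fun p => p.1 + p.2) := by
  refine (card_image_of_injOn fun p hp r hr h => ?_).ge
  have hp := hG p hp
  have hr := hG r hr
  exact Prod.ext (hp.trans hr.symm) (by simpa [hp, hr] using h)

end SparseSumProduct

open SparseSumProduct in
/-- The case `λ = 0` of the main theorem: with `π₁(G) = {a : ∃ b, (a,b) ∈ G}`,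
`max {|π₁(G)|, |A +_G B|, |A ·_G B|} ≥ c · |G|^(6/11)`. -/
theorem sums_products_projection_sparse_graphs :
    ∃ c : ℝ, 0 < c ∧
      ∀ (A B : Finset ℝ) (G : Finset (ℝ × ℝ)), G ⊆ A ×ˢ B →
        c * (G.card : ℝ) ^ ((6 : ℝ) / 11) ≤
          ((max (max (G.image Prod.fst).card
                     (G.image (fun p => p.1 + p.2)).card)
                (G.image (fun p => p.1 * p.2)).card : ℕ) : ℝ) := by
  refine ⟨1 / 5, by norm_num, fun _ _ G _ => ?_⟩
  rcases G.eq_empty_or_nonempty with rfl | hne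
  · simp
  set M := max (max (G.image Prod.fst).card (G.image (fun p => p.1 + p.2)).card)
    (G.image (fun p => p.1 * p.2)).card
  have hA : (G.image Prod.fst).card ≤ M := (le_max_left _ _).trans (le_max_left _ _)
  have hS : (G.image (fun p => p.1 + p.2)).card ≤ M := (le_max_right _ _).trans (le_max_left _ _)
  have hP : (G.image (fun p => p.1 * p.2)).card ≤ M := le_max_right _ _
  have hM : (1 : ℝ) ≤ M := by exact_mod_cast (hne.image _).card_pos.trans_le hA
  obtain ⟨x, hx, hMx⟩ : ∃ x : ℝ, 1 ≤ x ∧ (M : ℝ) = x ^ 6 := by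
    refine ⟨(M : ℝ) ^ ((1 : ℝ) / 6), Real.one_le_rpow hM (by norm_num), ?_⟩
    rw [← Real.rpow_natCast, ← Real.rpow_mul M.cast_nonneg]
    norm_num
  have hx0 : 0 < x := one_pos.trans_le hx
  have himg {β : Type} [DecidableEq β] (f : ℝ × ℝ → β) (P : ℝ × ℝ → Prop) [DecidablePred P] :
      ((G.filter P).image f).card ≤ (G.image f).card :=
    Finset.card_le_card (Finset.image_subset_image (Finset.filter_subset _ _))
  have h₀ := (card_le_of_fst_eq_zero (G.filter fun g => g.1 = 0)
    (fun g hg => (Finset.mem_filter.1 hg).2)).trans ((himg _ _).trans hS)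
  have h₁ := card_le_of_fst_ne_zero (G.filter fun g => ¬ g.1 = 0)
    (fun g hg => (Finset.mem_filter.1 hg).2) hx hMx ((himg _ _).trans hA) ((himg _ _).trans hS)
    ((himg _ _).trans hP)
  have hcard : (G.card : ℝ) ≤ 5 * x ^ 11 := by
    rw [← Finset.card_filter_add_card_filter_not (fun g : ℝ × ℝ => g.1 = 0), Nat.cast_add]
    have h₂ : x ^ 6 ≤ x ^ 11 := pow_le_pow_right₀ hx (by norm_num)
    have h₃ : ((G.filter fun g => g.1 = 0).card : ℝ) ≤ M := by exact_mod_cast h₀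
    linarith
  calc 1 / 5 * (G.card : ℝ) ^ ((6 : ℝ) / 11) ≤ 1 / 5 * (5 * x ^ 11) ^ ((6 : ℝ) / 11) := by gcongr
    _ = 1 / 5 * 5 ^ ((6 : ℝ) / 11) * x ^ 6 := by
        rw [Real.mul_rpow (by norm_num) (by positivity), ← Real.rpow_natCast x 11,
          ← Real.rpow_mul (by positivity), ← Real.rpow_natCast x 6]
        norm_num
        ring
    _ ≤ 1 / 5 * 5 ^ (1 : ℝ) * x ^ 6 := by
        gcongr <;> norm_num
    _ = M := by rw [hMx]; norm_num
end

section
/- For every λ ∈ ℤ there exist constants c > 0 and K > 0 such that for all sufficiently large natural numbers n the following holds: there exist a finite set A ⊆ ℝ with |A| ≤ n and a set G ⊆ A × A with |G| ≥ c · n^(8/5) / (log n)^4, such that max{|A +_G A|, |A +_G λA|, |A ·_G A|} ≤ K · n^(6/5). -/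
/-- The pairs of primes `u < v ≤ N`. -/
def primePairs (N : ℕ) : Finset (ℕ × ℕ) :=
  (N.primesLE ×ˢ N.primesLE).filter fun p => p.1 < p.2

theorem mem_primePairs {N : ℕ} {p : ℕ × ℕ} :
    p ∈ primePairs N ↔ p.1.Prime ∧ p.2.Prime ∧ p.1 < p.2 ∧ p.2 ≤ N := by
  simp only [primePairs, Finset.mem_filter, Finset.mem_product, Nat.mem_primesLE]
  constructor
  · rintro ⟨⟨⟨_, h1⟩, h2, h3⟩, h4⟩
    exact ⟨h1, h3, h4, h2⟩
  · rintro ⟨h1, h2, h3, h4⟩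
    exact ⟨⟨⟨by omega, h1⟩, h4, h2⟩, h3⟩

theorem primeCounting_sq_le (N : ℕ) :
    N.primeCounting ^ 2 ≤ 2 * (primePairs N).card + N.primeCounting := by
  have hsub : N.primesLE.offDiag ⊆ primePairs N ∪ (primePairs N).image Prod.swap := by
    rintro ⟨u, v⟩ h
    obtain ⟨hu, hv, huv⟩ := Finset.mem_offDiag.mp h
    simp only at hu hv huv
    rw [Finset.mem_union]
    rcases lt_or_gt_of_ne huv with hlt | hlt
    · exact Or.inl (by simp [primePairs, hu, hv, hlt])
    · exact Or.inr (Finset.mem_image.mpr ⟨(v, u), by simp [primePairs, hu, hv, hlt], rfl⟩)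
  have hcard := Finset.card_le_card hsub
  have hunion := Finset.card_union_le (primePairs N) ((primePairs N).image Prod.swap)
  have himage := Finset.card_image_le (s := primePairs N) (f := Prod.swap)
  rw [Finset.offDiag_card, Nat.primesLE_card_eq_primeCounting] at hcard
  rw [sq]
  omega

theorem div_four_mul_log_le_primeCounting {N : ℕ} (hN : 7 ≤ N) :
    (N : ℝ) / (4 * Real.log N) ≤ N.primeCounting := by
  have hN' : (7 : ℝ) ≤ N := by exact_mod_cast hN
  have hlog : 0 < Real.log N := Real.log_pos (by linarith)
  refine le_trans ?_ (Chebyshev.pi_ge N)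
  have h8 : Real.log ((N + 1 : ℝ) / 2 ^ 3) ≤ (N + 1 : ℝ) / 2 ^ 3 - 1 :=
    Real.log_le_sub_one_of_pos (by positivity)
  rw [Real.log_div (by positivity) (by norm_num), Real.log_pow] at h8
  push_cast at h8
  have hgt := Real.log_two_gt_d9
  have hlt := Real.log_two_lt_d9
  rw [← div_div]
  gcongr
  nlinarith

theorem div_sixty_four_mul_log_sq_le_card_primePairs {N : ℕ} (hN : 7 ≤ N) :
    (N : ℝ) ^ 2 / (64 * Real.log N ^ 2) ≤ (primePairs N).card := by
  have hpi := div_four_mul_log_le_primeCounting hN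
  have htwo : 2 ≤ N.primeCounting := by
    have h3 : Nat.primeCounting 3 = 2 := by decide
    exact h3 ▸ Nat.monotone_primeCounting (by omega : 3 ≤ N)
  have hsq : ((N.primeCounting : ℝ)) ^ 2 ≤ 2 * (primePairs N).card + N.primeCounting := by
    exact_mod_cast primeCounting_sq_le N
  have htwo' : (2 : ℝ) ≤ N.primeCounting := by exact_mod_cast htwo
  have hN' : (7 : ℝ) ≤ N := by exact_mod_cast hN
  have hlog : 0 < Real.log N := Real.log_pos (by linarith)
  have hpow : ((N : ℝ) / (4 * Real.log N)) ^ 2 ≤ (N.primeCounting : ℝ) ^ 2 := by gcongr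
  have heq : (N : ℝ) ^ 2 / (64 * Real.log N ^ 2) = ((N : ℝ) / (4 * Real.log N)) ^ 2 / 4 := by
    field_simp
    norm_num
  rw [heq]
  nlinarith

/-- If `u < v` and `u' < v'` are primes and `(u / v) / (u' / v')` is the square of a rational,
then `u = u'` and `v = v'`. -/
theorem eq_and_eq_of_sq_mul_eq {i i' u v u' v' : ℕ} (hi : i ≠ 0) (hi' : i' ≠ 0)
    (hu : u.Prime) (hv : v.Prime) (hu' : u'.Prime) (hv' : v'.Prime) (huv : u < v) (huv' : u' < v')
    (h : i ^ 2 * u * v' = i' ^ 2 * u' * v) : u = u' ∧ v = v' := by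
  have key (p : ℕ) := congrArg (fun m => m.factorization p) h
  have hfac (p : ℕ) : 2 * i.factorization p + Finsupp.single u 1 p + Finsupp.single v' 1 p =
      2 * i'.factorization p + Finsupp.single u' 1 p + Finsupp.single v 1 p := by
    have := key p
    rw [Nat.factorization_mul (mul_ne_zero (pow_ne_zero 2 hi) hu.ne_zero) hv'.ne_zero,
      Nat.factorization_mul (pow_ne_zero 2 hi) hu.ne_zero,
      Nat.factorization_mul (mul_ne_zero (pow_ne_zero 2 hi') hu'.ne_zero) hv.ne_zero,
      Nat.factorization_mul (pow_ne_zero 2 hi') hu'.ne_zero,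
      Nat.factorization_pow, Nat.factorization_pow, hu.factorization, hv.factorization,
      hu'.factorization, hv'.factorization] at this
    simpa using this
  have h1 := hfac u
  have h2 := hfac v
  simp only [Finsupp.single_apply] at h1 h2
  split_ifs at h1 h2 <;> omega

/-- The pair of reals `(i √u / √v, j √v / √u)`. -/
noncomputable def sqrtPair (q : (ℕ × ℕ) × ℕ × ℕ) : ℝ × ℝ :=
  (q.1.1 * √(q.2.1 : ℝ) / √(q.2.2 : ℝ), q.1.2 * √(q.2.2 : ℝ) / √(q.2.1 : ℝ))

/-- The index set of the edges: pairs `1 ≤ i, j ≤ N ^ 3` and primes `u < v ≤ N`. -/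
def edgeIndex (N : ℕ) : Finset ((ℕ × ℕ) × ℕ × ℕ) :=
  (Finset.Icc 1 (N ^ 3) ×ˢ Finset.Icc 1 (N ^ 3)) ×ˢ primePairs N

theorem mem_edgeIndex {N i j u v : ℕ} :
    ((i, j), (u, v)) ∈ edgeIndex N ↔
      ((1 ≤ i ∧ i ≤ N ^ 3) ∧ 1 ≤ j ∧ j ≤ N ^ 3) ∧ u.Prime ∧ v.Prime ∧ u < v ∧ v ≤ N := by
  simp [edgeIndex, mem_primePairs]

theorem sqrtPair_injOn (N : ℕ) : Set.InjOn sqrtPair (edgeIndex N) := by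
  rintro ⟨⟨i, j⟩, u, v⟩ hq ⟨⟨i', j'⟩, u', v'⟩ hq' h
  rw [Finset.mem_coe, mem_edgeIndex] at hq hq'
  obtain ⟨⟨⟨hi, -⟩, hj, -⟩, hu, hv, huv, -⟩ := hq
  obtain ⟨⟨⟨hi', -⟩, hj', -⟩, hu', hv', huv', -⟩ := hq'
  simp only [sqrtPair, Prod.mk.injEq] at h
  obtain ⟨ha, hb⟩ := h
  have hu0 : (0 : ℝ) < u := by exact_mod_cast hu.pos
  have hv0 : (0 : ℝ) < v := by exact_mod_cast hv.pos
  have hv0' : (0 : ℝ) < v' := by exact_mod_cast hv'.pos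
  have hsu := Real.sqrt_pos.mpr hu0
  have hsv := Real.sqrt_pos.mpr hv0
  have hsq := congrArg (· ^ 2) ha
  simp only [div_pow, mul_pow, Real.sq_sqrt (Nat.cast_nonneg _)] at hsq
  rw [div_eq_div_iff hv0.ne' hv0'.ne'] at hsq
  obtain ⟨rfl, rfl⟩ := eq_and_eq_of_sq_mul_eq (i := i) (i' := i') (by omega) (by omega)
    hu hv hu' hv' huv huv' (by exact_mod_cast hsq)
  rw [div_left_inj' hsv.ne', mul_left_inj' hsu.ne'] at ha
  rw [div_left_inj' hsu.ne', mul_left_inj' hsv.ne'] at hb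
  have hii : i = i' := by exact_mod_cast ha
  have hjj : j = j' := by exact_mod_cast hb
  rw [hii, hjj]

theorem card_image_sqrtPair (N : ℕ) :
    ((edgeIndex N).image sqrtPair).card = N ^ 6 * (primePairs N).card := by
  rw [Finset.card_image_of_injOn (sqrtPair_injOn N)]
  simp only [edgeIndex, Finset.card_product, Nat.card_Icc, Nat.add_sub_cancel]
  ring

/-- The reals `i √u / √v` with `1 ≤ i ≤ N ^ 3` and `1 ≤ u, v ≤ N`. -/
noncomputable def sqrtRatios (N : ℕ) : Finset ℝ :=
  (Finset.Icc 1 (N ^ 3) ×ˢ Finset.Icc 1 N ×ˢ Finset.Icc 1 N).image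
    fun q : ℕ × ℕ × ℕ => (q.1 : ℝ) * √(q.2.1 : ℝ) / √(q.2.2 : ℝ)

theorem card_sqrtRatios_le (N : ℕ) : (sqrtRatios N).card ≤ N ^ 5 := by
  refine Finset.card_image_le.trans (le_of_eq ?_)
  simp only [Finset.card_product, Nat.card_Icc, Nat.add_sub_cancel]
  ring

theorem image_sqrtPair_subset (N : ℕ) :
    (edgeIndex N).image sqrtPair ⊆ sqrtRatios N ×ˢ sqrtRatios N := by
  rw [Finset.image_subset_iff]
  rintro ⟨⟨i, j⟩, u, v⟩ hq
  obtain ⟨⟨hi, hj⟩, hu, hv, huv, hvN⟩ := mem_edgeIndex.mp hq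
  have hu' : u ∈ Finset.Icc 1 N := Finset.mem_Icc.mpr ⟨hu.one_le, by omega⟩
  have hv' : v ∈ Finset.Icc 1 N := Finset.mem_Icc.mpr ⟨hv.one_le, hvN⟩
  refine Finset.mem_product.mpr ⟨Finset.mem_image.mpr ⟨(i, u, v), ?_, rfl⟩,
    Finset.mem_image.mpr ⟨(j, v, u), ?_, rfl⟩⟩
  · exact Finset.mk_mem_product (Finset.mem_Icc.mpr hi) (Finset.mk_mem_product hu' hv')
  · exact Finset.mk_mem_product (Finset.mem_Icc.mpr hj) (Finset.mk_mem_product hv' hu')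

theorem card_image_mul_sqrtPair_le (N : ℕ) :
    (((edgeIndex N).image sqrtPair).image fun p => p.1 * p.2).card ≤ N ^ 6 := by
  have hsub : (((edgeIndex N).image sqrtPair).image fun p => p.1 * p.2) ⊆
      (Finset.Icc 1 (N ^ 6)).image fun m : ℕ => (m : ℝ) := by
    rw [Finset.image_image, Finset.image_subset_iff]
    rintro ⟨⟨i, j⟩, u, v⟩ hq
    obtain ⟨⟨hi, hj⟩, hu, hv, -, -⟩ := mem_edgeIndex.mp hq
    refine Finset.mem_image.mpr ⟨i * j, Finset.mem_Icc.mpr ⟨Nat.mul_pos hi.1 hj.1, ?_⟩, ?_⟩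
    · calc i * j ≤ N ^ 3 * N ^ 3 := Nat.mul_le_mul hi.2 hj.2
        _ = N ^ 6 := by ring
    · have hsu : √(u : ℝ) ≠ 0 := (Real.sqrt_pos.mpr (by exact_mod_cast hu.pos)).ne'
      have hsv : √(v : ℝ) ≠ 0 := (Real.sqrt_pos.mpr (by exact_mod_cast hv.pos)).ne'
      simp only [sqrtPair, Function.comp]
      push_cast
      field_simp
  calc _ ≤ _ := Finset.card_le_card hsub
    _ ≤ _ := Finset.card_image_le
    _ = N ^ 6 := by simp

theorem card_image_add_mul_sqrtPair_le {N : ℕ} (hN : 1 ≤ N) (lam : ℤ) :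
    (((edgeIndex N).image sqrtPair).image fun p => p.1 + (lam : ℝ) * p.2).card ≤
      (2 * lam.natAbs + 3) * N ^ 6 := by
  set B : ℕ := (lam.natAbs + 1) * N ^ 4 with hB
  have hsub : (((edgeIndex N).image sqrtPair).image fun p => p.1 + (lam : ℝ) * p.2) ⊆
      (Finset.Icc (-B : ℤ) B ×ˢ Finset.Icc 1 N ×ˢ Finset.Icc 1 N).image
        fun q : ℤ × ℕ × ℕ => (q.1 : ℝ) / (√(q.2.1 : ℝ) * √(q.2.2 : ℝ)) := by
    rw [Finset.image_image, Finset.image_subset_iff]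
    rintro ⟨⟨i, j⟩, u, v⟩ hq
    obtain ⟨⟨hi, hj⟩, hu, hv, huv, hvN⟩ := mem_edgeIndex.mp hq
    refine Finset.mem_image.mpr ⟨((i * u : ℕ) + lam * (j * v : ℕ), u, v), ?_, ?_⟩
    · refine Finset.mk_mem_product ?_ (Finset.mk_mem_product
        (Finset.mem_Icc.mpr ⟨hu.one_le, by omega⟩) (Finset.mem_Icc.mpr ⟨hv.one_le, hvN⟩))
      have hiu : i * u ≤ N ^ 4 := by
        calc i * u ≤ N ^ 3 * N := Nat.mul_le_mul hi.2 (by omega)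
          _ = N ^ 4 := by ring
      have hjv : j * v ≤ N ^ 4 := by
        calc j * v ≤ N ^ 3 * N := Nat.mul_le_mul hj.2 hvN
          _ = N ^ 4 := by ring
      rw [Finset.mem_Icc, ← abs_le]
      calc |((i * u : ℕ) : ℤ) + lam * (j * v : ℕ)|
          ≤ |((i * u : ℕ) : ℤ)| + |lam * (j * v : ℕ)| := abs_add_le _ _
        _ = (i * u : ℕ) + |lam| * (j * v : ℕ) := by
            rw [abs_mul, Nat.abs_cast, Nat.abs_cast]
        _ ≤ (N ^ 4 : ℕ) + |lam| * (N ^ 4 : ℕ) := by gcongr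
        _ = B := by rw [hB]; push_cast; ring
    · have hsu : √(u : ℝ) ≠ 0 := (Real.sqrt_pos.mpr (by exact_mod_cast hu.pos)).ne'
      have hsv : √(v : ℝ) ≠ 0 := (Real.sqrt_pos.mpr (by exact_mod_cast hv.pos)).ne'
      simp only [sqrtPair, Function.comp]
      push_cast
      field_simp
      rw [Real.sq_sqrt (Nat.cast_nonneg _), Real.sq_sqrt (Nat.cast_nonneg _)]
  have hcard : (Finset.Icc (-B : ℤ) B).card = 2 * B + 1 := by
    rw [Int.card_Icc]
    omega
  have hpow : 1 ≤ N ^ 4 := Nat.one_le_pow _ _ hN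
  calc _ ≤ _ := Finset.card_le_card hsub
    _ ≤ _ := Finset.card_image_le
    _ = (2 * B + 1) * (N * N) := by
        rw [Finset.card_product, Finset.card_product, hcard]
        simp
    _ ≤ (2 * B + N ^ 4) * (N * N) := by gcongr
    _ = (2 * lam.natAbs + 3) * N ^ 6 := by rw [hB]; ring

/-- Construction of Alon–Ruzsa–Solymosi: for any `λ ∈ ℤ`, there are constants
`c, K > 0` such that for all sufficiently large `n` there exist `A ⊆ ℝ` with
`|A| ≤ n` and `G ⊆ A × A` with `|G| ≥ c · n^(8/5) / (log n)^4` and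
`max {|A +_G A|, |A +_G λA|, |A ·_G A|} ≤ K · n^(6/5)`. -/
theorem ars_construction (lam : ℤ) :
    ∃ c > (0 : ℝ), ∃ K > (0 : ℝ), ∃ N : ℕ, ∀ n : ℕ, N ≤ n →
      ∃ (A : Finset ℝ) (G : Finset (ℝ × ℝ)), G ⊆ A ×ˢ A ∧
        A.card ≤ n ∧
        c * (n : ℝ) ^ ((8 : ℝ) / 5) / (Real.log n) ^ 4 ≤ (G.card : ℝ) ∧
        ((max (max (G.image (fun p => p.1 + p.2)).card
                   (G.image (fun p => p.1 + (lam : ℝ) * p.2)).card)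
              (G.image (fun p => p.1 * p.2)).card : ℕ) : ℝ) ≤
          K * (n : ℝ) ^ ((6 : ℝ) / 5) := by
  refine ⟨1 / 16384, by norm_num, 2 * lam.natAbs + 5, by positivity, 7 ^ 5, fun n hn => ?_⟩
  set x : ℝ := (n : ℝ) ^ ((1 : ℝ) / 5) with hx
  have hx0 : 0 ≤ x := by positivity
  have hxpow (k : ℕ) : (n : ℝ) ^ ((k : ℝ) / 5) = x ^ k := by
    rw [hx, ← Real.rpow_mul_natCast (Nat.cast_nonneg n)]
    congr 1
    ring
  have hx5 : x ^ 5 = n := by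
    rw [← hxpow 5]
    norm_num
  have hx7 : 7 ≤ x := by
    refine le_of_pow_le_pow_left₀ (n := 5) (by norm_num) hx0 ?_
    rw [hx5]
    exact_mod_cast hn
  set N : ℕ := ⌊x⌋₊ with hN
  have hNx : (N : ℝ) ≤ x := Nat.floor_le hx0
  have hN7 : 7 ≤ N := Nat.le_floor (by exact_mod_cast hx7)
  have hN7' : (7 : ℝ) ≤ N := by exact_mod_cast hN7
  have hxN : x / 2 ≤ N := by
    have := Nat.lt_floor_add_one x
    linarith
  have h85 : (n : ℝ) ^ ((8 : ℝ) / 5) = x ^ 8 := by exact_mod_cast hxpow 8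
  have h65 : (n : ℝ) ^ ((6 : ℝ) / 5) = x ^ 6 := by exact_mod_cast hxpow 6
  refine ⟨sqrtRatios N, (edgeIndex N).image sqrtPair, image_sqrtPair_subset N, ?_, ?_, ?_⟩
  · refine (card_sqrtRatios_le N).trans ?_
    have : (N : ℝ) ^ 5 ≤ n := by rw [← hx5]; gcongr
    exact_mod_cast this
  · have hlogN : 1 ≤ Real.log N := by
      rw [Real.le_log_iff_exp_le (by linarith)]
      linarith [Real.exp_one_lt_d9]
    have hlog : Real.log N ≤ Real.log n := by
      refine Real.log_le_log (by linarith) (hNx.trans ?_)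
      rw [← hx5]
      exact le_self_pow₀ (by linarith) (by norm_num)
    have hlog24 : Real.log N ^ 2 ≤ Real.log n ^ 4 :=
      calc Real.log N ^ 2 ≤ Real.log n ^ 2 := by gcongr
        _ ≤ Real.log n ^ 4 := pow_le_pow_right₀ (hlogN.trans hlog) (by norm_num)
    rw [h85, card_image_sqrtPair]
    push_cast
    calc 1 / 16384 * x ^ 8 / Real.log n ^ 4
        = (x / 2) ^ 8 / 64 / Real.log n ^ 4 := by ring
      _ ≤ (N : ℝ) ^ 8 / 64 / Real.log N ^ 2 := by gcongr
      _ = (N : ℝ) ^ 6 * ((N : ℝ) ^ 2 / (64 * Real.log N ^ 2)) := by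
          field_simp
      _ ≤ (N : ℝ) ^ 6 * (primePairs N).card := by
          gcongr
          exact div_sixty_four_mul_log_sq_le_card_primePairs hN7
  · have hone := card_image_add_mul_sqrtPair_le (by omega : 1 ≤ N) 1
    have hlam := card_image_add_mul_sqrtPair_le (by omega : 1 ≤ N) lam
    have hmul := card_image_mul_sqrtPair_le N
    simp only [Int.cast_one, one_mul, Int.natAbs_one] at hone
    rw [h65]
    calc _ ≤ (((2 * lam.natAbs + 5) * N ^ 6 : ℕ) : ℝ) := by
          refine Nat.cast_le.mpr (max_le (max_le (hone.trans ?_) (hlam.trans ?_)) (hmul.trans ?_))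
          · exact Nat.mul_le_mul_right _ (by omega)
          · exact Nat.mul_le_mul_right _ (by omega)
          · exact Nat.le_mul_of_pos_left _ (by omega)
      _ ≤ (2 * lam.natAbs + 5) * x ^ 6 := by
          push_cast
          gcongr
end

section
/- For every λ ∈ ℤ there exists a constant K > 0 such that for every N there exist a finite set A ⊆ ℝ and a set G ⊆ A × A with |G| ≥ N and max{|A +_G A|, |A +_G λA|, |A ·_G A|} ≤ K · |G|^(3/4) · (log |G|)^3. In particular, the exponent 6/11 in the lower bound max{|A +_G A|, |A +_G λA|, |A ·_G A|} ≫ |G|^(6/11) cannot be improved beyond 3/4. -/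
/-- At least a quarter of the integers in `[1, V]` are squarefree. -/
theorem le_four_mul_card_squarefree (V : ℕ) :
    V ≤ 4 * ((Finset.Icc 1 V).filter Squarefree).card := by
  have hsub : (Finset.Icc 1 V).filter (fun m => ¬ Squarefree m) ⊆
      (Finset.Icc 2 V).biUnion (fun d => (Finset.Ioc 0 V).filter (fun m => d ^ 2 ∣ m)) := by
    intro m hm
    simp only [Finset.mem_filter, Finset.mem_Icc, Finset.mem_biUnion, Finset.mem_Ioc] at hm ⊢
    obtain ⟨⟨h1, h2⟩, h3⟩ := hm
    rw [Nat.squarefree_iff_prime_squarefree] at h3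
    push Not at h3
    obtain ⟨p, hp, hpm⟩ := h3
    have hle := Nat.le_of_dvd h1 hpm
    have hp2 := hp.two_le
    exact ⟨p, ⟨hp2, by nlinarith⟩, ⟨h1, h2⟩, by rwa [sq]⟩
  have hbound : ∀ n : ℕ, ∑ d ∈ Finset.Icc 2 (n + 2), (1 : ℝ) / (d : ℝ) ^ 2
      ≤ 3 / 4 - 1 / ((n : ℝ) + 2) := by
    intro n
    induction n with
    | zero => norm_num
    | succ k ih =>
      rw [show k + 1 + 2 = (k + 2) + 1 by ring, Finset.sum_Icc_succ_top (by omega)]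
      have hk : (0 : ℝ) ≤ k := k.cast_nonneg
      have : (1 : ℝ) / ((k : ℝ) + 3) ^ 2 ≤ 1 / ((k : ℝ) + 2) - 1 / ((k : ℝ) + 3) := by
        rw [div_sub_div _ _ (by positivity) (by positivity),
          div_le_div_iff₀ (by positivity) (by positivity)]
        nlinarith
      push_cast
      rw [show (k : ℝ) + 2 + 1 = k + 3 by ring, show (k : ℝ) + 1 + 2 = k + 3 by ring]
      linarith
  have hsum : ∑ d ∈ Finset.Icc 2 V, (1 : ℝ) / (d : ℝ) ^ 2 ≤ 3 / 4 := by
    rcases lt_or_ge V 2 with h | h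
    · rw [Finset.Icc_eq_empty (by omega)]; norm_num
    · obtain ⟨n, rfl⟩ := Nat.exists_eq_add_of_le' h
      have : (0 : ℝ) ≤ 1 / ((n : ℝ) + 2) := by positivity
      linarith [hbound n]
  have hcard : (((Finset.Icc 1 V).filter (fun m => ¬ Squarefree m)).card : ℝ) ≤ 3 / 4 * V := by
    calc (((Finset.Icc 1 V).filter (fun m => ¬ Squarefree m)).card : ℝ)
        ≤ ∑ d ∈ Finset.Icc 2 V, ((((Finset.Ioc 0 V).filter (fun m => d ^ 2 ∣ m)).card : ℕ) : ℝ) := by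
          exact_mod_cast (Finset.card_le_card hsub).trans Finset.card_biUnion_le
      _ ≤ ∑ d ∈ Finset.Icc 2 V, (1 : ℝ) / (d : ℝ) ^ 2 * V := by
          refine Finset.sum_le_sum fun d _ => ?_
          rw [Nat.Ioc_filter_dvd_card_eq_div]
          refine Nat.cast_div_le.trans (le_of_eq ?_)
          push_cast
          ring
      _ ≤ 3 / 4 * V := by
          rw [← Finset.sum_mul]
          gcongr
  have htot := Finset.card_filter_add_card_filter_not (s := Finset.Icc 1 V) (p := Squarefree)
  rw [Nat.card_Icc, Nat.add_sub_cancel] at htot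
  have htot' : (((Finset.Icc 1 V).filter Squarefree).card : ℝ)
      + ((Finset.Icc 1 V).filter (fun m => ¬ Squarefree m)).card = V := by exact_mod_cast htot
  have : (V : ℝ) ≤ 4 * ((Finset.Icc 1 V).filter Squarefree).card := by linarith
  exact_mod_cast this

theorem Squarefree.eq_of_sq_mul_eq_sq_mul {m n u v : ℕ} (hm : Squarefree m) (hn : Squarefree n)
    (hu : u ≠ 0) (h : u ^ 2 * n = v ^ 2 * m) : m = n := by
  have hdvd : u ∣ v * m := by
    rw [← Nat.pow_dvd_pow_iff two_ne_zero]
    exact ⟨n * m, by rw [mul_pow, sq m, ← mul_assoc, ← h, mul_assoc]⟩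
  obtain ⟨c, hc⟩ := hdvd
  have hc2 : m * n = c ^ 2 := by
    have : u ^ 2 * (m * n) = u ^ 2 * c ^ 2 := by
      rw [← mul_pow, ← hc, mul_pow, mul_left_comm, h]; ring
    exact Nat.eq_of_mul_eq_mul_left (by positivity) this
  obtain ⟨d, rfl⟩ := (hm.dvd_pow_iff_dvd two_ne_zero).1 (Dvd.intro n hc2)
  have hnd : n = m * d ^ 2 :=
    Nat.eq_of_mul_eq_mul_left (Nat.pos_of_ne_zero hm.ne_zero) (by rw [hc2]; ring)
  have hd : d = 1 := Nat.isUnit_iff.1 (hn d ⟨m, by rw [hnd]; ring⟩)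
  simp [hnd, hd]

/-- The triples `(m, u, w)` with `m ≤ V` squarefree, `u ≤ V ^ 2` and `w ≤ V`, all positive. -/
def squarefreeTriples (V : ℕ) : Finset (ℕ × ℕ × ℕ) :=
  (Finset.Icc 1 V).filter Squarefree ×ˢ Finset.Icc 1 (V ^ 2) ×ˢ Finset.Icc 1 V

/-- The point `(u / √m, w √m)` attached to the triple `(m, u, w)`. -/
noncomputable def sqrtScaledPoint (t : ℕ × ℕ × ℕ) : ℝ × ℝ :=
  ((t.2.1 : ℝ) / √(t.1 : ℝ), (t.2.2 : ℝ) * √(t.1 : ℝ))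

theorem mem_squarefreeTriples {V : ℕ} {t : ℕ × ℕ × ℕ} :
    t ∈ squarefreeTriples V ↔ ((1 ≤ t.1 ∧ t.1 ≤ V) ∧ Squarefree t.1) ∧
      (1 ≤ t.2.1 ∧ t.2.1 ≤ V ^ 2) ∧ 1 ≤ t.2.2 ∧ t.2.2 ≤ V := by
  simp [squarefreeTriples]

theorem injOn_sqrtScaledPoint (V : ℕ) :
    Set.InjOn sqrtScaledPoint (squarefreeTriples V : Set (ℕ × ℕ × ℕ)) := by
  rintro ⟨m, u, w⟩ h ⟨n, v, z⟩ h' heq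
  rw [Finset.mem_coe, mem_squarefreeTriples] at h h'
  obtain ⟨⟨⟨hm, -⟩, hmsq⟩, ⟨hu, -⟩, -⟩ := h
  obtain ⟨⟨⟨hn, -⟩, hnsq⟩, -⟩ := h'
  simp only [sqrtScaledPoint, Prod.mk.injEq] at heq hm hn hmsq hnsq hu
  obtain ⟨h1, h2⟩ := heq
  have hm0 : (0 : ℝ) < m := by exact_mod_cast hm
  have hn0 : (0 : ℝ) < n := by exact_mod_cast hn
  have hmn : m = n := by
    refine hmsq.eq_of_sq_mul_eq_sq_mul hnsq (u := u) (v := v) (by omega) ?_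
    have h3 := congrArg (· ^ 2) h1
    simp only [div_pow, Real.sq_sqrt hm0.le, Real.sq_sqrt hn0.le] at h3
    rw [div_eq_div_iff hm0.ne' hn0.ne'] at h3
    exact_mod_cast h3
  subst hmn
  have hs : √(m : ℝ) ≠ 0 := (Real.sqrt_pos.2 hm0).ne'
  rw [div_left_inj' hs] at h1
  have h4 := mul_right_cancel₀ hs h2
  rw [Nat.cast_inj] at h1 h4
  rw [h1, h4]

theorem card_squarefreeTriples (V : ℕ) : V ^ 4 ≤ 4 * (squarefreeTriples V).card := by
  have h := le_four_mul_card_squarefree V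
  simp only [squarefreeTriples, Finset.card_product, Nat.card_Icc, Nat.add_sub_cancel]
  calc V ^ 4 = V * (V ^ 2 * V) := by ring
    _ ≤ 4 * ((Finset.Icc 1 V).filter Squarefree).card * (V ^ 2 * V) := by gcongr
    _ = _ := by ring

theorem card_image_add_intCast_mul_le (V : ℕ) (l : ℤ) :
    (((squarefreeTriples V).image sqrtScaledPoint).image
      (fun p => p.1 + (l : ℝ) * p.2)).card ≤ (2 * l.natAbs + 3) * V ^ 3 := by
  set B : ℕ := (l.natAbs + 1) * V ^ 2 with hB
  have hsub : ((squarefreeTriples V).image sqrtScaledPoint).image (fun p => p.1 + (l : ℝ) * p.2) ⊆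
      (Finset.Icc 1 V ×ˢ Finset.Icc (-(B : ℤ)) B).image
        (fun q : ℕ × ℤ => (q.2 : ℝ) / √(q.1 : ℝ)) := by
    intro x hx
    simp only [Finset.mem_image, exists_exists_and_eq_and] at hx
    obtain ⟨⟨m, u, w⟩, ht, rfl⟩ := hx
    rw [mem_squarefreeTriples] at ht
    obtain ⟨⟨hm, -⟩, hu, hw⟩ := ht
    simp only at hm hu hw
    have hm0 : (0 : ℝ) < m := by exact_mod_cast hm.1
    refine Finset.mem_image.2 ⟨(m, (u : ℤ) + l * (m * w : ℕ)), ?_, ?_⟩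
    · simp only [Finset.mem_product, Finset.mem_Icc]
      refine ⟨hm, abs_le.1 ?_⟩
      calc |(u : ℤ) + l * (m * w : ℕ)| ≤ |(u : ℤ)| + |l * (m * w : ℕ)| := abs_add_le _ _
        _ = ((u + l.natAbs * (m * w) : ℕ) : ℤ) := by
          rw [abs_mul, Nat.abs_cast, Nat.abs_cast]; push_cast; simp
        _ ≤ (B : ℤ) := by
          norm_cast
          calc u + l.natAbs * (m * w) ≤ V ^ 2 + l.natAbs * (V * V) := by
                gcongr <;> tauto
            _ = B := by rw [hB]; ring
    · have hs : √(m : ℝ) ≠ 0 := (Real.sqrt_pos.2 hm0).ne'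
      simp only [sqrtScaledPoint]
      push_cast
      field_simp
      rw [Real.sq_sqrt hm0.le]
      ring
  refine (Finset.card_le_card hsub).trans (Finset.card_image_le.trans ?_)
  rw [Finset.card_product, Nat.card_Icc, Int.card_Icc, Nat.add_sub_cancel,
    show ((B : ℤ) + 1 - -(B : ℤ)).toNat = 2 * B + 1 by omega, hB]
  rcases Nat.eq_zero_or_pos V with rfl | hV
  · simp
  · have : 1 ≤ V ^ 2 := Nat.one_le_pow _ _ hV
    calc V * (2 * ((l.natAbs + 1) * V ^ 2) + 1)
        ≤ V * (2 * ((l.natAbs + 1) * V ^ 2) + V ^ 2) := by gcongr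
      _ = _ := by ring

theorem card_image_mul_le (V : ℕ) :
    (((squarefreeTriples V).image sqrtScaledPoint).image (fun p => p.1 * p.2)).card ≤ V ^ 3 := by
  have hsub : ((squarefreeTriples V).image sqrtScaledPoint).image (fun p => p.1 * p.2) ⊆
      (Finset.Icc 1 (V ^ 3)).image (fun k : ℕ => (k : ℝ)) := by
    intro x hx
    simp only [Finset.mem_image, exists_exists_and_eq_and] at hx
    obtain ⟨⟨m, u, w⟩, ht, rfl⟩ := hx
    rw [mem_squarefreeTriples] at ht
    obtain ⟨⟨hm, -⟩, hu, hw⟩ := ht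
    simp only at hm hu hw
    have hm0 : (0 : ℝ) < m := by exact_mod_cast hm.1
    refine Finset.mem_image.2 ⟨u * w, Finset.mem_Icc.2 ⟨Nat.mul_pos hu.1 hw.1, ?_⟩, ?_⟩
    · exact (Nat.mul_le_mul hu.2 hw.2).trans (by rw [pow_succ V 2])
    · have hs : √(m : ℝ) ≠ 0 := (Real.sqrt_pos.2 hm0).ne'
      simp only [sqrtScaledPoint]
      push_cast
      field_simp
  refine (Finset.card_le_card hsub).trans (Finset.card_image_le.trans ?_)
  simp

/-- The exponent `6/11` cannot be improved beyond `3/4`: for every `λ ∈ ℤ`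
there is `K > 0` such that for every `N` there exist `A ⊆ ℝ` and `G ⊆ A × A`
with `|G| ≥ N` and
`max {|A +_G A|, |A +_G λA|, |A ·_G A|} ≤ K · |G|^(3/4) · (log |G|)^3`. -/
theorem exponent_limit (lam : ℤ) :
    ∃ K > (0 : ℝ), ∀ N : ℕ,
      ∃ (A : Finset ℝ) (G : Finset (ℝ × ℝ)), G ⊆ A ×ˢ A ∧
        N ≤ G.card ∧
        ((max (max (G.image (fun p => p.1 + p.2)).card
                   (G.image (fun p => p.1 + (lam : ℝ) * p.2)).card)
              (G.image (fun p => p.1 * p.2)).card : ℕ) : ℝ) ≤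
          K * (G.card : ℝ) ^ ((3 : ℝ) / 4) * (Real.log G.card) ^ 3 := by
  refine ⟨4 * ((2 * lam.natAbs + 5 : ℕ) : ℝ), by positivity, fun N => ?_⟩
  set V := N + 4 with hV
  set G := (squarefreeTriples V).image sqrtScaledPoint with hG
  have hcardG : V ^ 4 ≤ 4 * G.card := by
    rw [hG, Finset.card_image_of_injOn (injOn_sqrtScaledPoint V)]
    exact card_squarefreeTriples V
  have hVG : V ≤ G.card := by
    have h4 : 4 ≤ V := by omega
    have : 4 ^ 3 * V ≤ V ^ 4 := by
      rw [pow_succ V 3]; gcongr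
    omega
  refine ⟨G.image Prod.fst ∪ G.image Prod.snd, G, ?_, by omega, ?_⟩
  · intro p hp
    exact Finset.mem_product.2
      ⟨Finset.mem_union_left _ (Finset.mem_image_of_mem _ hp),
        Finset.mem_union_right _ (Finset.mem_image_of_mem _ hp)⟩
  have hmax : max (max (G.image (fun p => p.1 + p.2)).card
      (G.image (fun p => p.1 + (lam : ℝ) * p.2)).card)
      (G.image (fun p => p.1 * p.2)).card ≤ (2 * lam.natAbs + 5) * V ^ 3 := by
    have h1 := card_image_add_intCast_mul_le V 1
    simp only [Int.cast_one, one_mul, Int.natAbs_one] at h1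
    have h2 := card_image_add_intCast_mul_le V lam
    have h3 := card_image_mul_le V
    refine max_le (max_le (h1.trans ?_) (h2.trans ?_)) (h3.trans ?_)
    · exact Nat.mul_le_mul_right _ (by omega)
    · exact Nat.mul_le_mul_right _ (by omega)
    · exact Nat.le_mul_of_pos_left _ (by omega)
  have hlog : 1 ≤ Real.log G.card := by
    have h4 : (4 : ℝ) ≤ G.card := by exact_mod_cast (show 4 ≤ V by omega).trans hVG
    rw [Real.le_log_iff_exp_le (by linarith)]
    linarith [Real.exp_one_lt_d9]
  have hpow : (V : ℝ) ^ 3 ≤ 4 * (G.card : ℝ) ^ ((3 : ℝ) / 4) := by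
    have h0 : (V : ℝ) ^ 4 ≤ 4 * G.card := by exact_mod_cast hcardG
    calc (V : ℝ) ^ 3 = ((V : ℝ) ^ 4) ^ ((3 : ℝ) / 4) := by
          rw [← Real.rpow_natCast, ← Real.rpow_natCast, ← Real.rpow_mul (by positivity)]
          norm_num
      _ ≤ (4 * (G.card : ℝ)) ^ ((3 : ℝ) / 4) := by gcongr
      _ = (4 : ℝ) ^ ((3 : ℝ) / 4) * (G.card : ℝ) ^ ((3 : ℝ) / 4) :=
          Real.mul_rpow (by norm_num) (by positivity)
      _ ≤ 4 * (G.card : ℝ) ^ ((3 : ℝ) / 4) := by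
          gcongr
          exact (Real.rpow_le_rpow_of_exponent_le (by norm_num)
            (by norm_num : (3 : ℝ) / 4 ≤ 1)).trans_eq (Real.rpow_one 4)
  calc _ ≤ (((2 * lam.natAbs + 5) * V ^ 3 : ℕ) : ℝ) := by exact_mod_cast hmax
    _ = ((2 * lam.natAbs + 5 : ℕ) : ℝ) * (V : ℝ) ^ 3 := by push_cast; ring
    _ ≤ ((2 * lam.natAbs + 5 : ℕ) : ℝ) * (4 * (G.card : ℝ) ^ ((3 : ℝ) / 4)) := by gcongr
    _ = 4 * ((2 * lam.natAbs + 5 : ℕ) : ℝ) * (G.card : ℝ) ^ ((3 : ℝ) / 4) := by ring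
    _ ≤ _ := le_mul_of_one_le_right (by positivity) (one_le_pow₀ hlog)
end
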